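/- Let X be a Hilbert space and let f : X → ℝ ∪ {+∞} be a proper lower semicontinuous function that is both prox-regular and subdifferentially continuous at x̄ for x̄* = 0 ∈ ∂f(x̄). Then x̄ is a tilt-stable local minimizer of f with modulus κ > 0 if and only if there exists η > 0 such that ⟨u*, u⟩ ≥ (1/κ)·‖u‖² whenever u* ∈ ∂̆²f(x, x*)(u) with (x, x*) ∈ gph ∂f ∩ B_η(x̄, 0). -/

import Mathlib

open Filter Metric Topology RealInnerProductSpace

noncomputable section

variable {X : Type*} [NormedAddCommGroup X] [InnerProductSpace ℝ X]

/-- The regular/Fréchet subdifferential of `f` at `x` (Hilbert-space setting). -/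
def FrechetSubdiff (f : X → EReal) (x : X) : Set X :=
  {p | f x ≠ ⊤ ∧ ∀ ε : ℝ, 0 < ε → ∃ δ : ℝ, 0 < δ ∧
    ∀ y : X, ‖y - x‖ < δ → f x + ((⟪p, y - x⟫ - ε * ‖y - x‖ : ℝ) : EReal) ≤ f y}

/-- The limiting subdifferential of `f` at `x`: sequential weak outer limit of
Fréchet subdifferentials. -/
def LimitingSubdiff (f : X → EReal) (x : X) : Set X :=
  {p | ∃ (xs ps : ℕ → X),
    (∀ k, ps k ∈ FrechetSubdiff f (xs k)) ∧
    Tendsto xs atTop (𝓝 x) ∧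
    Tendsto (fun k => f (xs k)) atTop (𝓝 (f x)) ∧
    (∀ v : X, Tendsto (fun k => ⟪ps k, v⟫) atTop (𝓝 ⟪p, v⟫))}

def MetricallySubregularAt {A B : Type*} [PseudoMetricSpace A] [PseudoMetricSpace B]
    (F : A → Set B) (xb : A) (yb : B) (κ : ℝ) : Prop :=
  ∃ U ∈ 𝓝 xb, ∀ x ∈ U,
    EMetric.infEdist x {z | yb ∈ F z} ≤ ENNReal.ofReal κ * EMetric.infEdist yb (F x)

def StronglyMetricallySubregularAt {A B : Type*} [PseudoMetricSpace A] [PseudoMetricSpace B]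
    (F : A → Set B) (xb : A) (yb : B) (κ : ℝ) : Prop :=
  ∃ U ∈ 𝓝 xb, (∀ x ∈ U,
    EMetric.infEdist x {z | yb ∈ F z} ≤ ENNReal.ofReal κ * EMetric.infEdist yb (F x)) ∧
    {z | yb ∈ F z} ∩ U = {xb}

def MetricallyRegularAround {A B : Type*} [PseudoMetricSpace A] [PseudoMetricSpace B]
    (F : A → Set B) (xb : A) (yb : B) (κ : ℝ) : Prop :=
  ∃ U ∈ 𝓝 xb, ∃ V ∈ 𝓝 yb, ∀ x ∈ U, ∀ y ∈ V,
    EMetric.infEdist x {z | y ∈ F z} ≤ ENNReal.ofReal κ * EMetric.infEdist y (F x)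

def StronglyMetricallyRegularAround {A B : Type*} [PseudoMetricSpace A] [PseudoMetricSpace B]
    (F : A → Set B) (xb : A) (yb : B) (κ : ℝ) : Prop :=
  MetricallyRegularAround F xb yb κ ∧
  ∃ V ∈ 𝓝 yb, ∃ U ∈ 𝓝 xb, ∀ y ∈ V, ∃! x, x ∈ U ∧ y ∈ F x

/-- `f` is subdifferentially continuous at `xb` for `pb`: the map `(x, p) ↦ f x` is
continuous at `(xb, pb)` relative to the graph of the limiting subdifferential. -/
def SubdiffContAt (f : X → EReal) (xb pb : X) : Prop :=
  Tendsto (fun q : X × X => f q.1)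
    (𝓝[{q : X × X | q.2 ∈ LimitingSubdiff f q.1}] (xb, pb)) (𝓝 (f xb))

/-- `f` is prox-regular at `xb` for `pb`. -/
def ProxRegularAt (f : X → EReal) (xb pb : X) : Prop :=
  f xb ≠ ⊤ ∧ ∃ r : ℝ, 0 < r ∧ ∃ ε : ℝ, 0 < ε ∧
    ∀ x ∈ Metric.closedBall xb ε, ∀ u ∈ Metric.closedBall xb ε,
      f u ≤ f xb + (ε : EReal) → f xb ≤ f u + (ε : EReal) →
      ∀ p ∈ LimitingSubdiff f u, p ∈ Metric.closedBall pb ε →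
        f u + ((⟪p, x - u⟫ - r / 2 * ‖x - u‖ ^ 2 : ℝ) : EReal) ≤ f x

/-- The set of minimizers of the tilted function `x ↦ f x - ⟪p, x⟫` over the
closed ball of radius `γ` around `xb`. -/
def TiltArgmin (f : X → EReal) (xb : X) (γ : ℝ) (p : X) : Set X :=
  {x | x ∈ Metric.closedBall xb γ ∧ ∀ y ∈ Metric.closedBall xb γ,
    f x - ((⟪p, x⟫ : ℝ) : EReal) ≤ f y - ((⟪p, y⟫ : ℝ) : EReal)}

/-- `xb` is a tilt-stable local minimizer of `f` with modulus `κ`. -/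
def TiltStableWith (f : X → EReal) (xb : X) (κ : ℝ) : Prop :=
  ∃ γ : ℝ, 0 < γ ∧ ∃ V ∈ 𝓝 (0 : X), ∃ m : X → X,
    (∀ p ∈ V, TiltArgmin f xb γ p = {m p}) ∧
    LipschitzOnWith (Real.toNNReal κ) m V ∧ m 0 = xb

/-- `xb` is a tilt-stable local minimizer of `f`. -/
def TiltStable (f : X → EReal) (xb : X) : Prop :=
  ∃ γ : ℝ, 0 < γ ∧ ∃ V ∈ 𝓝 (0 : X), ∃ m : X → X, ∃ K : NNReal,
    (∀ p ∈ V, TiltArgmin f xb γ p = {m p}) ∧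
    LipschitzOnWith K m V ∧ m 0 = xb

/-- The Fréchet/regular normal cone to a subset of `X × X` at a point. -/
def FrechetNormalP (Ω : Set (X × X)) (zb : X × X) : Set (X × X) :=
  {w | ∀ ε : ℝ, 0 < ε → ∃ δ : ℝ, 0 < δ ∧ ∀ z ∈ Ω, dist z zb < δ →
    ⟪w.1, z.1 - zb.1⟫ + ⟪w.2, z.2 - zb.2⟫ ≤ ε * dist z zb}

/-- The combined second-order subdifferential of `f` at `x` for `p ∈ ∂f(x)`:
the regular coderivative of the limiting subdifferential mapping. -/
def CombinedSecondSubdiff (f : X → EReal) (x p u : X) : Set X :=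
  {w | (w, -u) ∈ FrechetNormalP {q : X × X | q.2 ∈ LimitingSubdiff f q.1} (x, p)}


section TiltAux

/-- Fixed points of contractions on a closed ball. -/
lemma aux_fixed [CompleteSpace X] (F : X → X) (c ρ : ℝ) (hc0 : 0 ≤ c) (hc : c < 1) (hρ : 0 ≤ ρ)
    (hL : ∀ a b : X, ‖a‖ ≤ ρ → ‖b‖ ≤ ρ → ‖F a - F b‖ ≤ c * ‖a - b‖)
    (h0 : ‖F 0‖ ≤ (1 - c) * ρ) : ∃ q, ‖q‖ ≤ ρ ∧ F q = q := by
  have hm : Set.MapsTo F (closedBall (0 : X) ρ) (closedBall (0 : X) ρ) := by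
    intro a ha
    rw [mem_closedBall_zero_iff] at ha ⊢
    have h1 := hL a 0 ha (by simpa using hρ)
    have h2 : ‖F a‖ ≤ ‖F a - F 0‖ + ‖F 0‖ := by
      simpa using norm_add_le (F a - F 0) (F 0)
    rw [sub_zero] at h1
    nlinarith [mul_le_mul_of_nonneg_left ha hc0]
  have hcon : ContractingWith (Real.toNNReal c) (hm.restrict F _ _) := by
    refine ⟨by rw [← Real.toNNReal_one]; exact (Real.toNNReal_lt_toNNReal_iff one_pos).2 hc, ?_⟩
    refine LipschitzWith.of_dist_le_mul ?_
    rintro ⟨a, ha⟩ ⟨b, hb⟩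
    rw [mem_closedBall_zero_iff] at ha hb
    rw [Real.coe_toNNReal _ hc0]
    simpa [Subtype.dist_eq, dist_eq_norm] using hL a b ha hb
  obtain ⟨q, hq, hfix, -⟩ := ContractingWith.exists_fixedPoint' (isClosed_closedBall.isComplete) hm hcon
    (x := (0 : X)) (by simpa using hρ) (edist_ne_top _ _)
  exact ⟨q, by simpa using hq, hfix⟩

/-- Descent-type lemma. -/
lemma aux_descent (α : X → ℝ) (m : X → X) (ρ K : ℝ) (hK : 0 ≤ K)
    (hsub : ∀ p p' : X, ‖p‖ < ρ → ‖p'‖ < ρ → α p + ⟪p, m p' - m p⟫ ≤ α p')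
    (hL : ∀ p p' : X, ‖p‖ < ρ → ‖p'‖ < ρ → ‖m p - m p'‖ ≤ K * ‖p - p'‖)
    (p p' : X) (hp : ‖p‖ < ρ) (hp' : ‖p'‖ < ρ) :
    ⟪p', m p'⟫ - α p' ≤ ⟪p, m p⟫ - α p + ⟪m p, p' - p⟫ + K / 2 * ‖p' - p‖ ^ 2 := by
  set d := p' - p with hd
  set g : X → ℝ := fun q => ⟪q, m q⟫ - α q with hg
  have key : ∀ N : ℕ, 0 < N → ∀ i : ℕ, i ≤ N →
      g (p + ((i : ℝ) / N) • d) ≤ g p + ((i : ℝ) / N) * ⟪m p, d⟫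
        + K * ‖d‖ ^ 2 * (i * (i + 1)) / (2 * N ^ 2) := by
    intro N hN
    have hN' : (0 : ℝ) < N := by exact_mod_cast hN
    have hball : ∀ i : ℕ, i ≤ N → ‖p + ((i : ℝ) / N) • d‖ < ρ := by
      intro i hi
      have h1 : ((i : ℝ) / N) ≤ 1 := by
        rw [div_le_one hN']; exact_mod_cast hi
      have h0 : 0 ≤ ((i : ℝ) / N) := by positivity
      have := (convex_ball (0 : X) ρ) (x := p) (by simpa using hp) (y := p') (by simpa using hp')
        (a := 1 - (i : ℝ) / N) (b := (i : ℝ) / N) (by linarith) h0 (by ring)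
      have e : (1 - (i : ℝ) / N) • p + ((i : ℝ) / N) • p' = p + ((i : ℝ) / N) • d := by
        rw [hd]; module
      rw [e] at this
      simpa using this
    intro i
    induction i with
    | zero => intro _; simp
    | succ i ih =>
      intro hi
      have ih' := ih (by omega)
      set a := p + ((i : ℝ) / N) • d with ha
      set b := p + (((i + 1 : ℕ) : ℝ) / N) • d with hb
      have hab := hball i (by omega)
      have hbb := hball (i + 1) hi
      have h1 := hsub a b hab hbb
      have h2 : b - a = (1 / (N : ℝ)) • d := by
        rw [ha, hb]; push_cast; rw [add_sub_add_left_eq_sub, ← sub_smul]; congr 1; ring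
      have h3 : g b ≤ g a + (1 / (N : ℝ)) * ⟪m b, d⟫ := by
        have : ⟪m b, b - a⟫ = (1 / (N : ℝ)) * ⟪m b, d⟫ := by rw [h2, inner_smul_right]
        rw [← this]
        simp only [hg]
        rw [inner_sub_right] at h1
        rw [inner_sub_right, real_inner_comm b, real_inner_comm a (m b)]
        linarith
      have h4 : ⟪m b, d⟫ ≤ ⟪m p, d⟫ + K * (((i : ℝ) + 1) / N) * ‖d‖ ^ 2 := by
        have h5 : ⟪m b - m p, d⟫ ≤ ‖m b - m p‖ * ‖d‖ := real_inner_le_norm _ _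
        have h6 := hL b p hbb hp
        have h7 : ‖b - p‖ = (((i : ℝ) + 1) / N) * ‖d‖ := by
          rw [hb, add_sub_cancel_left, norm_smul, Real.norm_of_nonneg (by positivity)]
          push_cast; rfl
        rw [inner_sub_left] at h5
        rw [h7] at h6
        nlinarith [mul_le_mul_of_nonneg_right h6 (norm_nonneg d)]
      have h8 : (1 / (N : ℝ)) * ⟪m b, d⟫ ≤
          (1 / (N : ℝ)) * (⟪m p, d⟫ + K * (((i : ℝ) + 1) / N) * ‖d‖ ^ 2) :=
        mul_le_mul_of_nonneg_left h4 (by positivity)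
      refine h3.trans ((add_le_add ih' h8).trans (le_of_eq ?_))
      push_cast
      field_simp
      ring
  have key2 : ∀ N : ℕ, g p' ≤ g p + ⟪m p, d⟫ + K / 2 * ‖d‖ ^ 2 * (1 + 1 / ((N : ℝ) + 1)) := by
    intro N
    have h := key (N + 1) (by omega) (N + 1) le_rfl
    have hN' : ((N : ℝ) + 1) ≠ 0 := by positivity
    push_cast at h
    rw [div_self hN', one_smul, hd, add_sub_cancel] at h
    refine h.trans (le_of_eq ?_)
    rw [← hd]
    field_simp
  have hlim : Tendsto (fun N : ℕ => g p + ⟪m p, d⟫ + K / 2 * ‖d‖ ^ 2 * (1 + 1 / ((N : ℝ) + 1)))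
      atTop (𝓝 (g p + ⟪m p, d⟫ + K / 2 * ‖d‖ ^ 2 * (1 + 0))) :=
    ((tendsto_one_div_add_atTop_nhds_zero_nat.const_add 1).const_mul _).const_add _
  have := ge_of_tendsto' hlim key2
  simpa only [add_zero, mul_one] using this

/-- Growth lemma. -/
lemma aux_growth (α : X → ℝ) (m : X → X) (ρ K : ℝ) (hK : 0 < K)
    (hsub : ∀ p p' : X, ‖p‖ < ρ → ‖p'‖ < ρ → α p + ⟪p, m p' - m p⟫ ≤ α p')
    (hL : ∀ p p' : X, ‖p‖ < ρ → ‖p'‖ < ρ → ‖m p - m p'‖ ≤ K * ‖p - p'‖)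
    (p y : X) (t : ℝ) (hp : ‖p‖ < ρ) (hp' : ‖p + K⁻¹ • (y - m p)‖ < ρ)
    (ht : ∀ q : X, ‖q‖ < ρ → α q + ⟪q, y - m q⟫ ≤ t) :
    α p + ⟪p, y - m p⟫ + K⁻¹ / 2 * ‖y - m p‖ ^ 2 ≤ t := by
  have h1 := aux_descent α m ρ K hK.le hsub hL p _ hp hp'
  have h2 := ht _ hp'
  set q := p + K⁻¹ • (y - m p) with hq
  have e : q - p = K⁻¹ • (y - m p) := by rw [hq]; abel
  have e2 : ⟪q, y - m p⟫ = ⟪p, y - m p⟫ + K⁻¹ * ‖y - m p‖ ^ 2 := by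
    rw [hq, inner_add_left, inner_smul_left, real_inner_self_eq_norm_sq]; simp
  have e3 : ⟪m p, q - p⟫ = ⟪q, m p⟫ - ⟪p, m p⟫ := by
    rw [inner_sub_right, real_inner_comm q, real_inner_comm p]
  have e4 : K / 2 * ‖q - p‖ ^ 2 = K⁻¹ / 2 * ‖y - m p‖ ^ 2 := by
    rw [e, norm_smul, Real.norm_of_nonneg (by positivity)]; field_simp
  rw [e3, e4] at h1
  rw [inner_sub_right] at h2 e2
  linarith

/-- A smooth variational principle (Borwein and Preiss type). -/
lemma aux_variational [CompleteSpace X] (E : Set (X × ℝ)) (hE : IsClosed E) (hne : E.Nonempty)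
    (R B : ℝ) (hR : ∀ z ∈ E, ‖z.1‖ ≤ R) (hB : ∀ z ∈ E, B ≤ z.2) (μ : ℝ) (hμ : 0 < μ) :
    ∃ z ∈ E, ∃ g : X, ∃ c : ℝ, ‖g‖ ≤ μ ∧ 0 ≤ c ∧ c ≤ μ ∧
      ∀ z' ∈ E, z.2 + ⟪g, z'.1 - z.1⟫ - c / 2 * ‖z'.1 - z.1‖ ^ 2 ≤ z'.2 := by
  obtain ⟨e0, he0⟩ := hne
  have hR0 : 0 ≤ R := (norm_nonneg _).trans (hR _ he0)
  set μ0 : ℝ := μ / (4 * R + 2) with hμ0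
  have hμ0p : 0 < μ0 := by positivity
  set H : ℝ × X → X × ℝ → ℝ := fun s z => z.2 + s.1 / 2 * ‖z.1‖ ^ 2 - ⟪s.2, z.1⟫ with hH
  have hpick : ∀ (s : ℝ × X) (δ : ℝ), ∃ z ∈ E, 0 < δ → ∀ z' ∈ E, H s z ≤ H s z' + δ := by
    intro s δ
    by_cases hδ : 0 < δ
    swap
    · exact ⟨e0, he0, fun h => absurd h hδ⟩
    have hbdd : BddBelow (H s '' E) := by
      refine ⟨B - |s.1| / 2 * R ^ 2 - ‖s.2‖ * R, ?_⟩
      rintro _ ⟨z, hz, rfl⟩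
      have h1 := hR z hz
      have h2 := hB z hz
      have h3 : ⟪s.2, z.1⟫ ≤ ‖s.2‖ * R :=
        (real_inner_le_norm _ _).trans (mul_le_mul_of_nonneg_left h1 (norm_nonneg _))
      have h4 : -(|s.1| * R ^ 2) ≤ s.1 * ‖z.1‖ ^ 2 := by
        have h5 : ‖z.1‖ ^ 2 ≤ R ^ 2 := by gcongr
        have h6 := neg_abs_le s.1
        nlinarith [abs_nonneg s.1, sq_nonneg ‖z.1‖]
      simp only [hH]
      linarith
    obtain ⟨_, ⟨z, hz, rfl⟩, hlt⟩ := exists_lt_of_csInf_lt ((Set.nonempty_of_mem he0).image (H s))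
      (lt_add_of_pos_right (sInf (H s '' E)) hδ)
    refine ⟨z, hz, fun _ z' hz' => ?_⟩
    have := csInf_le hbdd ⟨z', hz', rfl⟩
    linarith
  choose pick hpE hpick using hpick
  set μs : ℕ → ℝ := fun n => μ0 * (1 / 2) ^ n with hμs
  set δs : ℕ → ℝ := fun n => μ0 * (1 / 8) ^ n / 4 with hδs
  have hδp : ∀ n, 0 < δs n := fun n => by simp only [hδs]; positivity
  let st : ℕ → ℝ × X := fun n => Nat.rec ((0 : ℝ), (0 : X))
    (fun n s => (s.1 + μs n, s.2 + μs n • (pick s (δs n)).1)) n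
  set z : ℕ → X × ℝ := fun n => pick (st n) (δs n) with hz
  have hst0 : st 0 = (0, 0) := rfl
  have hst : ∀ n, st (n + 1) = ((st n).1 + μs n, (st n).2 + μs n • (z n).1) := fun n => rfl
  have hzE : ∀ n, z n ∈ E := fun n => hpE _ _
  have hmin : ∀ n, ∀ z' ∈ E, H (st n) (z n) ≤ H (st n) z' + δs n :=
    fun n => hpick _ _ (hδp n)
  clear_value st z
  have hμp : ∀ n, 0 < μs n := fun n => by simp only [hμs]; positivity
  have hstep : ∀ n w, H (st (n + 1)) w = H (st n) w + μs n / 2 * ‖w.1 - (z n).1‖ ^ 2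
      - μs n / 2 * ‖(z n).1‖ ^ 2 := by
    intro n w
    simp only [hH, hst, inner_add_left, inner_smul_left, norm_sub_sq_real, conj_trivial]
    rw [real_inner_comm (z n).1 w.1]
    ring
  have hdiff : ∀ n, ‖(z n).1 - (z (n + 1)).1‖ ≤ 1 * (1 / 2 : ℝ) ^ n := by
    intro n
    have h1 := hmin n _ (hzE (n + 1))
    have h2 := hmin (n + 1) _ (hzE n)
    rw [hstep, hstep, sub_self, norm_zero] at h2
    have h3 : δs (n + 1) ≤ δs n := by
      simp only [hδs, pow_succ]
      have : (0 : ℝ) < (1 / 8) ^ n := by positivity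
      nlinarith [mul_pos hμ0p this]
    have h4 : μs n / 2 * ‖(z (n + 1)).1 - (z n).1‖ ^ 2 ≤ 2 * δs n := by linarith
    have h5 : 2 * δs n = μs n / 2 * ((1 / 2 : ℝ) ^ n) ^ 2 := by
      simp only [hδs, hμs]
      have : ((1 : ℝ) / 8) ^ n = (1 / 2) ^ n * ((1 / 2) ^ n) ^ 2 := by
        rw [← pow_mul, mul_comm n 2, pow_mul, ← mul_pow]; norm_num
      rw [this]; ring
    rw [h5] at h4
    have h6 := le_of_mul_le_mul_left h4 (by have := hμp n; positivity)
    rw [norm_sub_rev, one_mul]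
    exact le_of_sq_le_sq h6 (by positivity)
  obtain ⟨y, hy⟩ := cauchySeq_tendsto_of_complete (cauchySeq_of_le_geometric (1 / 2 : ℝ) 1
    (by norm_num) (f := fun n => (z n).1) (fun n => by rw [dist_eq_norm]; exact hdiff n))
  have hcform : ∀ n, (st n).1 = 2 * μ0 * (1 - (1 / 2) ^ n) := by
    intro n
    induction n with
    | zero => simp [hst0]
    | succ n ih => rw [hst]; simp only [ih, hμs, pow_succ]; ring
  have hclim : Tendsto (fun n => (st n).1) atTop (𝓝 (2 * μ0)) := by
    simp only [hcform]
    have := ((tendsto_pow_atTop_nhds_zero_of_lt_one (r := (1 / 2 : ℝ)) (by norm_num)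
      (by norm_num)).const_sub 1).const_mul (2 * μ0)
    simpa using this
  have hbb : ∀ n, ‖(st n).2‖ ≤ (st n).1 * R := by
    intro n
    induction n with
    | zero => simp [hst0]
    | succ n ih =>
      rw [hst]
      refine (norm_add_le _ _).trans ?_
      rw [norm_smul, Real.norm_of_nonneg (hμp n).le]
      have := mul_le_mul_of_nonneg_left (hR _ (hzE n)) (hμp n).le
      simp only; linarith
  obtain ⟨b, hb⟩ := cauchySeq_tendsto_of_complete (cauchySeq_of_le_geometric (1 / 2 : ℝ) (μ0 * R)
    (by norm_num) (f := fun n => (st n).2) (fun n => by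
      rw [dist_comm, dist_eq_norm, hst]
      simp only [add_sub_cancel_left]
      rw [norm_smul, Real.norm_of_nonneg (hμp n).le]
      have := mul_le_mul_of_nonneg_left (hR _ (hzE n)) (hμp n).le
      simp only [hμs] at this ⊢
      linarith))
  have hc2 : ∀ n, 0 ≤ (st n).1 ∧ (st n).1 ≤ 2 * μ0 := by
    intro n
    rw [hcform]
    have h1 : (0 : ℝ) ≤ (1 / 2) ^ n := by positivity
    have h2 : (1 / 2 : ℝ) ^ n ≤ 1 := pow_le_one₀ (by norm_num) (by norm_num)
    constructor
    · exact mul_nonneg (by positivity) (by linarith)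
    · nlinarith
  have ht : ∃ M, ∀ n, (z n).2 ∈ Set.Icc B M := by
    refine ⟨e0.2 + 2 * μ0 / 2 * R ^ 2 + 2 * (2 * μ0 * R * R) + μ0, fun n => ⟨hB _ (hzE n), ?_⟩⟩
    have h1 := hmin n e0 he0
    simp only [hH] at h1
    have h2 : δs n ≤ μ0 := by
      simp only [hδs]
      have h2 : (1 / 8 : ℝ) ^ n ≤ 1 := pow_le_one₀ (by norm_num) (by norm_num)
      nlinarith
    obtain ⟨h3, h4⟩ := hc2 n
    have h5 : ‖(st n).2‖ ≤ 2 * μ0 * R := (hbb n).trans (by gcongr)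
    have h6 : ⟪(st n).2, (z n).1⟫ ≤ 2 * μ0 * R * R :=
      (real_inner_le_norm _ _).trans (mul_le_mul h5 (hR _ (hzE n)) (norm_nonneg _) (by positivity))
    have h7 : -⟪(st n).2, e0.1⟫ ≤ 2 * μ0 * R * R := by
      rw [← inner_neg_right]
      refine (real_inner_le_norm _ _).trans (mul_le_mul h5 ?_ (norm_nonneg _) (by positivity))
      rw [norm_neg]; exact hR _ he0
    have h8 : (st n).1 / 2 * ‖e0.1‖ ^ 2 ≤ 2 * μ0 / 2 * R ^ 2 := by
      have := hR _ he0
      gcongr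
    have h9 : 0 ≤ (st n).1 / 2 * ‖(z n).1‖ ^ 2 := by positivity
    linarith
  obtain ⟨M, hM⟩ := ht
  obtain ⟨t, -, φ, hφ, htt⟩ := isCompact_Icc.tendsto_subseq hM
  have hφt := hφ.tendsto_atTop
  have hyφ := hy.comp hφt
  have hcφ := hclim.comp hφt
  have hbφ := hb.comp hφt
  have hδ0 : Tendsto δs atTop (𝓝 0) := by
    have := ((tendsto_pow_atTop_nhds_zero_of_lt_one (r := (1 / 8 : ℝ)) (by norm_num)
      (by norm_num)).const_mul μ0).div_const 4
    rw [mul_zero, zero_div] at this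
    exact this
  have hytE : (y, t) ∈ E := hE.mem_of_tendsto (hyφ.prodMk_nhds htt) (Eventually.of_forall fun n => hzE (φ n))
  have hbn : ‖b‖ ≤ 2 * μ0 * R := by
    refine le_of_tendsto hb.norm (Eventually.of_forall fun n => (hbb n).trans ?_)
    have := (hc2 n).2
    gcongr
  have hyR : ‖y‖ ≤ R := hR _ hytE
  have hμe : μ0 * (4 * R + 2) = μ := by rw [hμ0]; field_simp
  refine ⟨(y, t), hytE, b - (2 * μ0) • y, 2 * μ0, ?_, by positivity, ?_, ?_⟩
  · refine (norm_sub_le _ _).trans ?_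
    rw [norm_smul, Real.norm_of_nonneg (by positivity)]
    nlinarith
  · nlinarith [mul_nonneg hμ0p.le hR0]
  · intro z' hz'
    have hl : Tendsto (fun n => H (st (φ n)) (z (φ n))) atTop (𝓝 (H (2 * μ0, b) (y, t))) := by
      simp only [hH]
      exact (htt.add ((hcφ.div_const 2).mul (hyφ.norm.pow 2))).sub (hbφ.inner hyφ)
    have hr : Tendsto (fun n => H (st (φ n)) z' + δs (φ n)) atTop (𝓝 (H (2 * μ0, b) z' + 0)) := by
      simp only [hH]
      exact (((hcφ.div_const 2).mul_const _).const_add _ |>.sub (hbφ.inner tendsto_const_nhds)).add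
        (hδ0.comp hφt)
    have h := le_of_tendsto_of_tendsto' hl hr (fun n => hmin _ _ hz')
    simp only [hH, add_zero] at h
    rw [inner_sub_left, inner_smul_left, norm_sub_sq_real, inner_sub_right, inner_sub_right,
      real_inner_self_eq_norm_sq, real_inner_comm y z'.1]
    simp only [conj_trivial]
    linarith

/-- Upper quadratic estimate for the norm away from zero. -/
lemma aux_norm_upper (a x y : X) (hx : 0 < ‖x - a‖) :
    ‖y - a‖ ≤ ‖x - a‖ + ‖x - a‖⁻¹ * ⟪x - a, y - x⟫ + ‖x - a‖⁻¹ / 2 * ‖y - x‖ ^ 2 := by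
  have e : ‖y - a‖ ^ 2 = ‖x - a‖ ^ 2 + 2 * ⟪x - a, y - x⟫ + ‖y - x‖ ^ 2 := by
    rw [← norm_add_sq_real]; congr 2; abel
  set d := ‖x - a‖ with hd
  have h : 2 * d * ‖y - a‖ ≤ 2 * d * (d + d⁻¹ * ⟪x - a, y - x⟫ + d⁻¹ / 2 * ‖y - x‖ ^ 2) := by
    have : 2 * d * (d + d⁻¹ * ⟪x - a, y - x⟫ + d⁻¹ / 2 * ‖y - x‖ ^ 2)
      = 2 * d ^ 2 + 2 * ⟪x - a, y - x⟫ + ‖y - x‖ ^ 2 := by field_simp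
    rw [this]
    nlinarith [sq_nonneg (d - ‖y - a‖)]
  exact le_of_mul_le_mul_left h (by positivity)

set_option maxHeartbeats 1000000 in
lemma aux_mv_local [CompleteSpace X] (φ : X → ℝ) (ρ K L : ℝ) (hK : 0 ≤ K) (hL0 : 0 ≤ L)
    (hLip : ∀ a b : X, ‖a‖ < ρ → ‖b‖ < ρ → |φ a - φ b| ≤ K * ‖a - b‖)
    (hsub : ∀ x : X, ‖x‖ < ρ → ∀ v : X, ∀ C δ : ℝ, 0 ≤ C → 0 < δ →
      (∀ y : X, ‖y - x‖ < δ → φ x + ⟪v, y - x⟫ - C * ‖y - x‖ ^ 2 ≤ φ y) → ‖v‖ ≤ L)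
    (a : X) (ha : ‖a‖ < ρ) (L2 : ℝ) (hL2 : L < L2) :
    ∃ δ : ℝ, 0 < δ ∧ ∀ b : X, ‖b - a‖ < δ → φ a - L2 * ‖b - a‖ ≤ φ b := by
  set L1 := (L + L2) / 2 with hL1
  set τ := (ρ - ‖a‖) / 2 with hτ
  have hτp : 0 < τ := by rw [hτ]; linarith
  have hin : ∀ y, ‖y - a‖ ≤ τ → ‖y‖ < ρ := by
    intro y hy
    have : ‖y‖ ≤ ‖y - a‖ + ‖a‖ := by simpa using norm_add_le (y - a) a
    linarith
  set C := (K + 1) / τ with hC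
  have hCp : 0 < C := by positivity
  have hCτ : C * τ = K + 1 := by rw [hC]; field_simp
  refine ⟨min τ ((L2 - L1) / C), lt_min hτp (div_pos (by linarith) hCp), ?_⟩
  intro b hb
  by_contra hcon
  push Not at hcon
  have hb1 : ‖b - a‖ < τ := hb.trans_le (min_le_left _ _)
  have hb2 : C * ‖b - a‖ < L2 - L1 := by
    have := hb.trans_le (min_le_right _ _)
    rw [lt_div_iff₀ hCp] at this; linarith
  set ψ : X → ℝ := fun y => φ y + L1 * ‖y - a‖ + C * ‖y - a‖ ^ 2 with hψ
  have hgap : ψ b < φ a := by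
    simp only [hψ]
    nlinarith [mul_le_mul_of_nonneg_right hb2.le (norm_nonneg (b - a))]
  have hφc : ContinuousOn φ (closedBall a τ) := by
    refine LipschitzOnWith.continuousOn (K := Real.toNNReal K)
      (LipschitzOnWith.of_dist_le_mul ?_)
    intro x hx y hy
    rw [mem_closedBall, dist_eq_norm] at hx hy
    rw [Real.coe_toNNReal _ hK, Real.dist_eq, dist_eq_norm]
    exact hLip x y (hin x hx) (hin y hy)
  have hψc : ContinuousOn ψ (closedBall a τ) := by
    refine (hφc.add ?_).add ?_ <;> fun_prop
  have hE : IsClosed {z : X × ℝ | z.1 ∈ closedBall a τ ∧ ψ z.1 ≤ z.2} :=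
    isClosed_closedBall.epigraph hψc
  set g0 := φ a - ψ b with hg0
  have hg0p : 0 < g0 := by rw [hg0]; linarith
  set μ := min ((L1 - L) / 2) (g0 / (2 * (2 * τ + 2 * τ ^ 2))) with hμ
  have hμp : 0 < μ := lt_min (by linarith) (by positivity)
  have hμ1 : μ ≤ (L1 - L) / 2 := min_le_left _ _
  have hμ2 : μ * (2 * (2 * τ + 2 * τ ^ 2)) ≤ g0 := by
    have : μ ≤ g0 / (2 * (2 * τ + 2 * τ ^ 2)) := min_le_right _ _
    rwa [le_div_iff₀ (by positivity)] at this
  have hlow : ∀ y, ‖y - a‖ ≤ τ → φ a - K * ‖y - a‖ ≤ φ y := by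
    intro y hy
    have := (abs_le.1 (hLip y a (hin y hy) ha)).1
    linarith
  obtain ⟨⟨x, t⟩, ⟨hxB, hxt⟩, g, c, hg, hc0, hcμ, hmin⟩ := aux_variational _ hE
    ⟨(a, ψ a), by simpa using hτp.le, le_rfl⟩ ρ (φ a - K * τ)
    (by
      rintro ⟨y, t⟩ ⟨hy, -⟩
      rw [mem_closedBall, dist_eq_norm] at hy
      exact (hin y hy).le)
    (by
      rintro ⟨y, t⟩ ⟨hy, ht⟩
      rw [mem_closedBall, dist_eq_norm] at hy
      have h1 := hlow y hy
      simp only [hψ] at ht hy ⊢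
      have h2 : 0 ≤ L1 * ‖y - a‖ := mul_nonneg (by linarith) (norm_nonneg _)
      have h3 : 0 ≤ C * ‖y - a‖ ^ 2 := by positivity
      nlinarith [mul_le_mul_of_nonneg_left hy hK]) μ hμp
  simp only at hxB hxt hmin
  rw [mem_closedBall, dist_eq_norm] at hxB
  have hmin' : ∀ y, ‖y - a‖ ≤ τ → ψ x + ⟪g, y - x⟫ - c / 2 * ‖y - x‖ ^ 2 ≤ ψ y := by
    intro y hy
    have := hmin (y, ψ y) ⟨by rw [mem_closedBall, dist_eq_norm]; exact hy, le_rfl⟩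
    simp only at this
    linarith
  have hψx : ψ x < φ a := by
    have h1 := hmin' b hb1.le
    have h2 : ‖b - x‖ ≤ 2 * τ := by
      have : ‖b - x‖ ≤ ‖b - a‖ + ‖x - a‖ := by
        have := norm_sub_le (b - a) (x - a)
        simpa using this
      linarith
    have h3 : -⟪g, b - x⟫ ≤ μ * (2 * τ) := by
      rw [← inner_neg_right]
      refine (real_inner_le_norm _ _).trans ?_
      rw [norm_neg]
      gcongr
    have h4 : c / 2 * ‖b - x‖ ^ 2 ≤ μ / 2 * (2 * τ) ^ 2 := by gcongr
    nlinarith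
  have hxa : 0 < ‖x - a‖ := by
    rw [norm_pos_iff, sub_ne_zero]
    rintro rfl
    simp [hψ] at hψx
  have hxτ : ‖x - a‖ < τ := by
    refine lt_of_le_of_ne hxB fun he => ?_
    have h1 := hlow x hxB
    simp only [hψ] at hψx
    have h2 : 0 ≤ L1 * ‖x - a‖ := mul_nonneg (by linarith) (norm_nonneg _)
    rw [he] at h1 h2 hψx
    nlinarith
  set d := ‖x - a‖ with hd
  have hL1p : 0 < L1 := by linarith
  have := hsub x (hin x hxB) (g - (L1 * d⁻¹ + 2 * C) • (x - a)) (L1 * (d⁻¹ / 2) + C + c / 2)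
    (τ - d) (by positivity) (by linarith) (by
      intro y hy
      have hya : ‖y - a‖ ≤ τ := by
        have : ‖y - a‖ ≤ ‖y - x‖ + ‖x - a‖ := by simpa using norm_add_le (y - x) (x - a)
        linarith
      have h1 := hmin' y hya
      have h2 := mul_le_mul_of_nonneg_left (aux_norm_upper a x y hxa) hL1p.le
      have e : ‖y - a‖ ^ 2 = d ^ 2 + 2 * ⟪x - a, y - x⟫ + ‖y - x‖ ^ 2 := by
        rw [hd, ← norm_add_sq_real]; congr 2; abel
      simp only [hψ] at h1
      rw [e, ← hd] at h1
      rw [← hd] at h2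
      rw [inner_sub_left, inner_smul_left]
      simp only [conj_trivial]
      nlinarith)
  have h5 : ‖(L1 * d⁻¹ + 2 * C) • (x - a)‖ = L1 + 2 * C * d := by
    rw [norm_smul, Real.norm_of_nonneg (by positivity), ← hd]; field_simp
  have h6 : ‖(L1 * d⁻¹ + 2 * C) • (x - a)‖ - ‖g‖ ≤ ‖g - (L1 * d⁻¹ + 2 * C) • (x - a)‖ := by
    rw [norm_sub_rev]; exact norm_sub_norm_le _ _
  rw [h5] at h6
  have : 0 < 2 * C * d := by positivity
  linarith

/-- Mean value inequality through proximal subgradients. -/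
lemma aux_mv [CompleteSpace X] (φ : X → ℝ) (ρ K L : ℝ) (hK : 0 ≤ K) (hL0 : 0 ≤ L)
    (hLip : ∀ a b : X, ‖a‖ < ρ → ‖b‖ < ρ → |φ a - φ b| ≤ K * ‖a - b‖)
    (hsub : ∀ x : X, ‖x‖ < ρ → ∀ v : X, ∀ C δ : ℝ, 0 ≤ C → 0 < δ →
      (∀ y : X, ‖y - x‖ < δ → φ x + ⟪v, y - x⟫ - C * ‖y - x‖ ^ 2 ≤ φ y) → ‖v‖ ≤ L)
    (a b : X) (ha : ‖a‖ < ρ) (hb : ‖b‖ < ρ) : φ a - L * ‖b - a‖ ≤ φ b := by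
  have main : ∀ L2 : ℝ, L < L2 → φ a - L2 * ‖b - a‖ ≤ φ b := by
    intro L2 hL2
    set γ : ℝ → X := fun t => a + t • (b - a) with hγ
    have hγb : ∀ t ∈ Set.Icc (0 : ℝ) 1, ‖γ t‖ < ρ := by
      intro t ht
      have := (convex_ball (0 : X) ρ) (x := a) (by simpa using ha) (y := b) (by simpa using hb)
        (a := 1 - t) (b := t) (by linarith [ht.2]) ht.1 (by ring)
      have e : (1 - t) • a + t • b = γ t := by simp only [hγ]; module
      rw [e] at this
      simpa using this
    have hγd : ∀ t t', γ t' - γ t = (t' - t) • (b - a) := by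
      intro t t'; simp only [hγ]; module
    set S : Set ℝ := {t | φ a - L2 * t * ‖b - a‖ ≤ φ (γ t)} with hS
    have hφc : ContinuousOn φ (ball 0 ρ) := by
      refine LipschitzOnWith.continuousOn (K := Real.toNNReal K)
        (LipschitzOnWith.of_dist_le_mul ?_)
      intro x hx y hy
      rw [mem_ball_zero_iff] at hx hy
      rw [Real.coe_toNNReal _ hK, Real.dist_eq, dist_eq_norm]
      exact hLip x y hx hy
    have hcomp : ContinuousOn (fun t => φ (γ t)) (Set.Icc 0 1) :=
      hφc.comp (by simp only [hγ]; fun_prop) (fun t ht => by simpa using hγb t ht)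
    have hcl : IsClosed (S ∩ Set.Icc 0 1) := by
      have := ContinuousOn.preimage_isClosed_of_isClosed
        (f := fun t => φ (γ t) - (φ a - L2 * t * ‖b - a‖)) (s := Set.Icc (0 : ℝ) 1) (t := Set.Ici 0)
        (hcomp.sub (by fun_prop)) isClosed_Icc isClosed_Ici
      convert this using 1
      ext t
      simp only [hS, Set.mem_inter_iff, Set.mem_setOf_eq, Set.mem_preimage, Set.mem_Ici, sub_nonneg]
      exact and_comm
    have hsubset := hcl.Icc_subset_of_forall_exists_gt (by simp [hS, hγ])
      (by
        rintro t ⟨htS, ht0, ht1⟩ t2 ht2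
        obtain ⟨δ, hδ, hloc⟩ := aux_mv_local φ ρ K L hK hL0 hLip hsub (γ t)
          (hγb t ⟨ht0, ht1.le⟩) L2 hL2
        set h := min (t2 - t) (δ / (2 * (‖b - a‖ + 1))) with hh
        have hnb := norm_nonneg (b - a)
        have hhp : 0 < h := lt_min (by linarith [Set.mem_Ioi.1 ht2]) (by positivity)
        refine ⟨t + h, ?_, by linarith, by linarith [min_le_left (t2 - t) (δ / (2 * (‖b - a‖ + 1)))]⟩
        have hhδ : h * (2 * (‖b - a‖ + 1)) ≤ δ := by
          have : h ≤ _ := min_le_right _ _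
          rwa [le_div_iff₀ (by positivity)] at this
        have hn : ‖γ (t + h) - γ t‖ = h * ‖b - a‖ := by
          rw [hγd, add_sub_cancel_left, norm_smul, Real.norm_of_nonneg hhp.le]
        have := hloc (γ (t + h)) (by rw [hn]; nlinarith)
        rw [hn] at this
        simp only [hS, Set.mem_setOf_eq] at htS ⊢
        nlinarith)
    have h1 : (1 : ℝ) ∈ S := hsubset (by simp)
    simp only [hS, hγ, Set.mem_setOf_eq, one_smul, add_sub_cancel, mul_one] at h1
    exact h1
  have hlim : Tendsto (fun n : ℕ => φ a - (L + 1 / ((n : ℝ) + 1)) * ‖b - a‖) atTop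
      (𝓝 (φ a - (L + 0) * ‖b - a‖)) :=
    ((tendsto_one_div_add_atTop_nhds_zero_nat.const_add L).mul_const _).const_sub _
  rw [add_zero] at hlim
  exact le_of_tendsto' hlim fun n => main _ (by
    have : (0 : ℝ) < 1 / ((n : ℝ) + 1) := by positivity
    linarith)

lemma aux_coe (f : X → EReal) (hbot : ∀ x, f x ≠ ⊥) (x : X) (hx : f x ≠ ⊤) :
    f x = (((f x).toReal : ℝ) : EReal) := (EReal.coe_toReal hx (hbot x)).symm

lemma aux_frechet (f : X → EReal) (hbot : ∀ x, f x ≠ ⊥) (x p : X) (hx : f x ≠ ⊤) (C δ : ℝ)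
    (hC : 0 ≤ C) (hδ : 0 < δ)
    (h : ∀ y, ‖y - x‖ < δ → f y ≠ ⊤ →
      (f x).toReal + ⟪p, y - x⟫ - C * ‖y - x‖ ^ 2 ≤ (f y).toReal) :
    p ∈ FrechetSubdiff f x := by
  refine ⟨hx, fun ε hε => ⟨min δ (ε / (C + 1)), lt_min hδ (by positivity), fun y hy => ?_⟩⟩
  by_cases hy' : f y = ⊤
  · rw [hy']; exact le_top
  have h1 := h y (hy.trans_le (min_le_left _ _)) hy'
  have h2 := hy.trans_le (min_le_right _ _)
  rw [lt_div_iff₀ (by positivity)] at h2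
  rw [aux_coe f hbot x hx, aux_coe f hbot y hy', ← EReal.coe_add, EReal.coe_le_coe_iff]
  have h3 : C * ‖y - x‖ ^ 2 ≤ ε * ‖y - x‖ := by
    nlinarith [mul_le_mul_of_nonneg_right h2.le (norm_nonneg (y - x)), sq_nonneg ‖y - x‖]
  linarith

lemma aux_limiting (f : X → EReal) (x p : X) (h : p ∈ FrechetSubdiff f x) :
    p ∈ LimitingSubdiff f x :=
  ⟨fun _ => x, fun _ => p, fun _ => h, tendsto_const_nhds, tendsto_const_nhds,
    fun _ => tendsto_const_nhds⟩

/-- Uniform prox-inequality on a localized graph, in real-valued form. -/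
def AuxProx (f : X → EReal) (xb : X) (r ε : ℝ) : Prop :=
  ∀ u p : X, p ∈ LimitingSubdiff f u → ‖u - xb‖ ≤ ε → ‖p‖ ≤ ε → f u ≠ ⊤ ∧
    ∀ x, ‖x - xb‖ ≤ ε → f x ≠ ⊤ →
      (f u).toReal + ⟪p, x - u⟫ - r / 2 * ‖x - u‖ ^ 2 ≤ (f x).toReal

lemma aux_setup (f : X → EReal) (hbot : ∀ x, f x ≠ ⊥) (xb : X)
    (hpr : ProxRegularAt f xb 0) (hsc : SubdiffContAt f xb 0) :
    ∃ r ε : ℝ, 0 < r ∧ 0 < ε ∧ AuxProx f xb r ε := by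
  obtain ⟨hfin, r, hr, ε, hε, H⟩ := hpr
  have hxb := aux_coe f hbot xb hfin
  have h1 : f xb < f xb + (ε : EReal) := by
    rw [hxb, ← EReal.coe_add, EReal.coe_lt_coe_iff]; linarith
  have h2 : f xb - (ε : EReal) < f xb := by
    rw [hxb, ← EReal.coe_sub, EReal.coe_lt_coe_iff]; linarith
  have h3 := hsc.eventually (Ioo_mem_nhds h2 h1)
  rw [eventually_nhdsWithin_iff, Metric.eventually_nhds_iff] at h3
  obtain ⟨δ, hδ, h3⟩ := h3
  refine ⟨r, min (δ / 2) ε, hr, lt_min (by positivity) hε, ?_⟩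
  intro u p hp hu hpn
  have hlt := h3 (y := (u, p)) (by
    rw [Prod.dist_eq, dist_eq_norm, dist_eq_norm, sub_zero]
    have := min_le_left (δ / 2) ε
    exact max_lt (by linarith) (by linarith)) hp
  have hutop : f u ≠ ⊤ := by
    refine ne_top_of_lt hlt.2
  refine ⟨hutop, fun x hx hxt => ?_⟩
  have hε' := min_le_right (δ / 2) ε
  have h4 : f xb ≤ f u + (ε : EReal) := by
    have h5 := hlt.1.le
    simp only at h5
    rw [hxb, aux_coe f hbot u hutop] at h5 ⊢
    rw [← EReal.coe_sub, EReal.coe_le_coe_iff] at h5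
    rw [← EReal.coe_add, EReal.coe_le_coe_iff]; linarith
  have := H x (by rw [mem_closedBall, dist_eq_norm]; linarith) u
    (by rw [mem_closedBall, dist_eq_norm]; linarith) hlt.2.le h4 p hp
    (by rw [mem_closedBall_zero_iff]; linarith)
  rw [aux_coe f hbot u hutop, aux_coe f hbot x hxt, ← EReal.coe_add, EReal.coe_le_coe_iff] at this
  linarith

lemma aux_hypo (f : X → EReal) (xb : X) (r ε : ℝ) (H : AuxProx f xb r ε)
    (x p x' p' : X) (hp : p ∈ LimitingSubdiff f x) (hp' : p' ∈ LimitingSubdiff f x')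
    (hx : ‖x - xb‖ ≤ ε) (hpn : ‖p‖ ≤ ε) (hx' : ‖x' - xb‖ ≤ ε) (hpn' : ‖p'‖ ≤ ε) :
    -r * ‖x - x'‖ ^ 2 ≤ ⟪p - p', x - x'⟫ := by
  obtain ⟨h1, h2⟩ := H x p hp hx hpn
  obtain ⟨h1', h2'⟩ := H x' p' hp' hx' hpn'
  have a := h2 x' hx' h1'
  have b := h2' x hx h1
  have e : ⟪p, x' - x⟫ = -⟪p, x - x'⟫ := by rw [← inner_neg_right, neg_sub]
  rw [e, norm_sub_rev] at a
  rw [inner_sub_left]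
  linarith

/-- Uniqueness / Lipschitz estimate for the localized resolvent. -/
lemma aux_resolvent (f : X → EReal) (xb : X) (r ε : ℝ) (H : AuxProx f xb r ε)
    (x p x' p' q q' : X) (hp : p ∈ LimitingSubdiff f x) (hp' : p' ∈ LimitingSubdiff f x')
    (hx : ‖x - xb‖ ≤ ε) (hpn : ‖p‖ ≤ ε) (hx' : ‖x' - xb‖ ≤ ε) (hpn' : ‖p'‖ ≤ ε)
    (hq : p + (r + 1) • (x - xb) = q) (hq' : p' + (r + 1) • (x' - xb) = q') :
    ‖x - x'‖ ≤ ‖q - q'‖ := by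
  have h := aux_hypo f xb r ε H x p x' p' hp hp' hx hpn hx' hpn'
  have e : p - p' = (q - q') - (r + 1) • (x - x') := by rw [← hq, ← hq']; module
  rw [e, inner_sub_left, inner_smul_left, real_inner_self_eq_norm_sq] at h
  simp only [conj_trivial] at h
  have h2 := real_inner_le_norm (q - q') (x - x')
  by_contra hcon
  push Not at hcon
  nlinarith [norm_nonneg (q - q'), norm_nonneg (x - x')]

lemma aux_dense [CompleteSpace X] (f : X → EReal) (hbot : ∀ x, f x ≠ ⊥)
    (hlsc : LowerSemicontinuous f) (xb : X) (h0 : (0 : X) ∈ LimitingSubdiff f xb) (r ε ε' : ℝ)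
    (hr : 0 < r) (hε' : 0 < ε') (hεε : ε' ≤ ε) (H : AuxProx f xb r ε)
    (q : X) (hq : ‖q‖ ≤ ε' / (16 * (2 + r))) (ν : ℝ) (hν : 0 < ν) :
    ∃ x p : X, p ∈ FrechetSubdiff f x ∧ ‖x - xb‖ ≤ ε' ∧ ‖p‖ ≤ ε' ∧
      ‖p + (r + 1) • (x - xb) - q‖ ≤ ν := by
  set ρ := ε' / (16 * (2 + r)) with hρ
  have hρp : 0 < ρ := by positivity
  have hρe : ρ * (16 * (2 + r)) = ε' := by rw [hρ]; field_simp
  have hε : 0 < ε := by linarith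
  obtain ⟨hfin, hgr⟩ := H xb 0 h0 (by simpa using hε.le) (by simpa using hε.le)
  set s := r + 1 with hs
  have hE : IsClosed {z : X × ℝ | z.1 ∈ closedBall xb ε ∧
      f z.1 ≤ ((z.2 - s / 2 * ‖z.1 - xb‖ ^ 2 + ⟪q, z.1 - xb⟫ : ℝ) : EReal)} := by
    refine (isClosed_closedBall.preimage continuous_fst).inter ?_
    have hc : Continuous (fun z : X × ℝ =>
        (z.1, ((z.2 - s / 2 * ‖z.1 - xb‖ ^ 2 + ⟪q, z.1 - xb⟫ : ℝ) : EReal))) := by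
      refine continuous_fst.prodMk (continuous_coe_real_ereal.comp ?_)
      fun_prop
    exact hlsc.isClosed_epigraph.preimage hc
  set ν' := min (min ν (1 / 2)) ρ with hν'
  have hν'p : 0 < ν' := lt_min (lt_min hν (by norm_num)) hρp
  have hν1 : ν' ≤ ν := (min_le_left _ _).trans (min_le_left _ _)
  have hν2 : ν' ≤ 1 / 2 := (min_le_left _ _).trans (min_le_right _ _)
  have hν3 : ν' ≤ ρ := min_le_right _ _
  have hlow : ∀ y, ‖y - xb‖ ≤ ε → f y ≠ ⊤ →
      (f xb).toReal - r / 2 * ‖y - xb‖ ^ 2 ≤ (f y).toReal := by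
    intro y hy hyt
    have := hgr y hy hyt
    simpa using this
  obtain ⟨⟨y, t⟩, ⟨hyB, hyt⟩, g, c, hg, hc0, hcν, hmin⟩ := aux_variational _ hE
    ⟨(xb, (f xb).toReal), by simpa using hε.le, by
      simp [EReal.coe_toReal hfin (hbot xb)]⟩ (‖xb‖ + ε)
    ((f xb).toReal - r / 2 * ε ^ 2 - ‖q‖ * ε)
    (by
      rintro ⟨y, t⟩ ⟨hy, -⟩
      rw [mem_closedBall, dist_eq_norm] at hy
      have : ‖y‖ ≤ ‖xb‖ + ‖y - xb‖ := by simpa using norm_add_le xb (y - xb)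
      simp only at hy ⊢
      linarith)
    (by
      rintro ⟨y, t⟩ ⟨hy, ht⟩
      rw [mem_closedBall, dist_eq_norm] at hy
      simp only at hy ht ⊢
      have hyt : f y ≠ ⊤ := ne_top_of_le_ne_top (EReal.coe_ne_top _) ht
      have h1 := hlow y hy hyt
      rw [aux_coe f hbot y hyt, EReal.coe_le_coe_iff] at ht
      have h2 : ⟪q, y - xb⟫ ≤ ‖q‖ * ε :=
        (real_inner_le_norm _ _).trans (mul_le_mul_of_nonneg_left hy (norm_nonneg _))
      have h3 : ‖y - xb‖ ^ 2 ≤ ε ^ 2 := by gcongr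
      have h4 : 0 ≤ s / 2 * ‖y - xb‖ ^ 2 := by positivity
      nlinarith) ν' hν'p
  simp only at hyB hyt hmin
  rw [mem_closedBall, dist_eq_norm] at hyB
  have hytop : f y ≠ ⊤ := ne_top_of_le_ne_top (EReal.coe_ne_top _) hyt
  have hyt' := hyt
  rw [aux_coe f hbot y hytop, EReal.coe_le_coe_iff] at hyt'
  have hmin' : ∀ y', ‖y' - xb‖ ≤ ε → f y' ≠ ⊤ →
      (f y).toReal + s / 2 * ‖y - xb‖ ^ 2 - ⟪q, y - xb⟫ + ⟪g, y' - y⟫ - c / 2 * ‖y' - y‖ ^ 2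
        ≤ (f y').toReal + s / 2 * ‖y' - xb‖ ^ 2 - ⟪q, y' - xb⟫ := by
    intro y' hy' hyt2
    have := hmin (y', (f y').toReal + s / 2 * ‖y' - xb‖ ^ 2 - ⟪q, y' - xb⟫)
      ⟨by rw [mem_closedBall, dist_eq_norm]; exact hy', by
        simp only
        nth_rewrite 1 [aux_coe f hbot y' hyt2]
        rw [EReal.coe_le_coe_iff]; linarith⟩
    simp only at this
    linarith
  set d := ‖y - xb‖ with hd
  have hd0 : 0 ≤ d := norm_nonneg _
  have hdle : d ≤ 4 * (‖q‖ + ν') := by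
    have h1 := hmin' xb (by simpa using hε.le) hfin
    have h2 := hlow y hyB hytop
    rw [← hd] at h2
    have h3 : ⟪q, y - xb⟫ ≤ ‖q‖ * d := real_inner_le_norm _ _
    have h4 : -⟪g, xb - y⟫ ≤ ν' * d := by
      rw [← inner_neg_right, neg_sub]
      exact (real_inner_le_norm _ _).trans (mul_le_mul_of_nonneg_right hg hd0)
    rw [norm_sub_rev xb y, ← hd] at h1
    simp only [sub_self, norm_zero, inner_zero_right] at h1
    by_contra hcon
    push Not at hcon
    have h5 : c / 2 * d ^ 2 ≤ 1 / 4 * d ^ 2 := by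
      have : c ≤ 1 / 2 := hcν.trans hν2
      nlinarith [sq_nonneg d]
    have hdp : 0 < d := lt_of_le_of_lt (by positivity) hcon
    nlinarith [mul_lt_mul_of_pos_left hcon hdp]
  have hdε : d ≤ ε' / 2 := by nlinarith
  refine ⟨y, q - s • (y - xb) + g, ?_, by linarith, ?_, ?_⟩
  · refine aux_frechet f hbot y _ hytop ((s + c) / 2) (ε / 2) (by positivity) (by positivity) ?_
    intro y' hy' hyt2
    have hyb : ‖y' - xb‖ ≤ ε := by
      have : ‖y' - xb‖ ≤ ‖y' - y‖ + ‖y - xb‖ := by simpa using norm_add_le (y' - y) (y - xb)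
      linarith
    have h1 := hmin' y' hyb hyt2
    have e : ‖y' - xb‖ ^ 2 = d ^ 2 + 2 * ⟪y - xb, y' - y⟫ + ‖y' - y‖ ^ 2 := by
      rw [hd, ← norm_add_sq_real]; congr 2; abel
    have e2 : ⟪q, y' - xb⟫ = ⟪q, y - xb⟫ + ⟪q, y' - y⟫ := by
      rw [← inner_add_right]; congr 1; abel
    rw [e, e2] at h1
    rw [inner_add_left, inner_sub_left, inner_smul_left]
    simp only [conj_trivial]
    linarith
  · have h1 : ‖q - s • (y - xb) + g‖ ≤ ‖q‖ + s * d + ‖g‖ := by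
      refine (norm_add_le _ _).trans (add_le_add_left ?_ _)
      refine (norm_sub_le _ _).trans ?_
      rw [norm_smul, Real.norm_of_nonneg (by positivity)]
    have h2 : s * d ≤ s * (8 * ρ) := by
      refine mul_le_mul_of_nonneg_left ?_ (by positivity)
      linarith
    nlinarith
  · have : q - s • (y - xb) + g + s • (y - xb) - q = g := by abel
    rw [this]; linarith

lemma aux_surj [CompleteSpace X] (f : X → EReal) (hbot : ∀ x, f x ≠ ⊥)
    (hlsc : LowerSemicontinuous f) (xb : X) (h0 : (0 : X) ∈ LimitingSubdiff f xb) (r ε ε' : ℝ)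
    (hr : 0 < r) (hε' : 0 < ε') (hεε : ε' ≤ ε) (H : AuxProx f xb r ε)
    (q : X) (hq : ‖q‖ ≤ ε' / (16 * (2 + r))) :
    ∃ x p : X, p ∈ LimitingSubdiff f x ∧ ‖x - xb‖ ≤ ε' ∧ ‖p‖ ≤ ε' ∧
      p + (r + 1) • (x - xb) = q := by
  have hε : 0 < ε := by linarith
  have hd : ∀ n : ℕ, _ := fun n => aux_dense f hbot hlsc xb h0 r ε ε' hr hε' hεε H q hq
    (1 * (1 / 2) ^ n) (by positivity)
  choose x p hF hx hp hn using hd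
  have hl : ∀ n, p n ∈ LimitingSubdiff f (x n) := fun n => aux_limiting f _ _ (hF n)
  have hqlim : Tendsto (fun n => p n + (r + 1) • (x n - xb)) atTop (𝓝 q) := by
    rw [tendsto_iff_norm_sub_tendsto_zero]
    refine squeeze_zero (fun _ => norm_nonneg _) hn ?_
    simpa using (tendsto_pow_atTop_nhds_zero_of_lt_one (r := (1 / 2 : ℝ)) (by norm_num)
      (by norm_num)).const_mul 1
  have hcau : CauchySeq x := by
    have hc := hqlim.cauchySeq
    rw [Metric.cauchySeq_iff] at hc ⊢
    intro e he
    obtain ⟨N, hN⟩ := hc e he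
    refine ⟨N, fun m hm n hn => lt_of_le_of_lt ?_ (hN m hm n hn)⟩
    rw [dist_eq_norm, dist_eq_norm]
    exact aux_resolvent f xb r ε H _ _ _ _ _ _ (hl m) (hl n) ((hx m).trans hεε)
      ((hp m).trans hεε) ((hx n).trans hεε) ((hp n).trans hεε) rfl rfl
  obtain ⟨xl, hxl⟩ := cauchySeq_tendsto_of_complete hcau
  have hpl : Tendsto p atTop (𝓝 (q - (r + 1) • (xl - xb))) := by
    have := hqlim.sub ((hxl.sub_const xb).const_smul (r + 1))
    simpa using this
  have hxlb : ‖xl - xb‖ ≤ ε' := le_of_tendsto' (hxl.sub_const xb).norm hx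
  obtain ⟨hfin, -⟩ := H xb 0 h0 (by simpa using hε.le) (by simpa using hε.le)
  have hHn := fun n => H (x n) (p n) (hl n) ((hx n).trans hεε) ((hp n).trans hεε)
  have up : ∀ y, ‖y - xb‖ ≤ ε → f y ≠ ⊤ → ∀ n, f (x n) ≤
      (((f y).toReal - ⟪p n, y - x n⟫ + r / 2 * ‖y - x n‖ ^ 2 : ℝ) : EReal) := by
    intro y hy hyt n
    obtain ⟨h1, h2⟩ := hHn n
    have := h2 y hy hyt
    rw [aux_coe f hbot _ h1, EReal.coe_le_coe_iff]
    linarith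
  have uplim : ∀ y, Tendsto (fun n =>
      (((f y).toReal - ⟪p n, y - x n⟫ + r / 2 * ‖y - x n‖ ^ 2 : ℝ) : EReal)) atTop
      (𝓝 (((f y).toReal - ⟪q - (r + 1) • (xl - xb), y - xl⟫ + r / 2 * ‖y - xl‖ ^ 2 : ℝ) : EReal)) := by
    intro y
    refine (continuous_coe_real_ereal.tendsto _).comp ?_
    exact ((hpl.inner (hxl.const_sub y)).const_sub _).add
      (((hxl.const_sub y).norm.pow 2).const_mul _)
  have hlscx : ∀ c, c < f xl → ∀ᶠ n in atTop, c < f (x n) :=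
    fun c hc => hxl.eventually (hlsc xl c hc)
  have hxlt : f xl ≠ ⊤ := by
    intro htop
    have h1 := uplim xb
    set cc := (((f xb).toReal - ⟪q - (r + 1) • (xl - xb), xb - xl⟫ + r / 2 * ‖xb - xl‖ ^ 2 : ℝ))
      with hcc
    have h2 : ((cc : ℝ) : EReal) < ((cc + 1 : ℝ) : EReal) := by
      rw [EReal.coe_lt_coe_iff]; linarith
    have h3 := h1.eventually (gt_mem_nhds h2)
    have h4 := hlscx ((cc + 1 : ℝ) : EReal) (by rw [htop]; exact EReal.coe_lt_top _)
    obtain ⟨n, h5, h6⟩ := (h3.and h4).exists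
    exact absurd ((up xb (by simpa using hε.le) hfin n).trans_lt h5) (not_lt.2 h6.le)
  have hflim : Tendsto (fun n => f (x n)) atTop (𝓝 (f xl)) := by
    have h1 := uplim xl
    simp only [sub_self, inner_zero_right, norm_zero, sub_zero, ne_eq, OfNat.ofNat_ne_zero,
      not_false_eq_true, zero_pow, mul_zero, add_zero] at h1
    rw [← aux_coe f hbot xl hxlt] at h1
    rw [tendsto_order]
    refine ⟨hlscx, fun c hc => ?_⟩
    filter_upwards [h1.eventually (gt_mem_nhds hc)] with n hn
    exact (up xl (hxlb.trans hεε) hxlt n).trans_lt hn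
  refine ⟨xl, q - (r + 1) • (xl - xb), ⟨x, p, hF, hxl, hflim, fun v => hpl.inner tendsto_const_nhds⟩,
    hxlb, le_of_tendsto' hpl.norm hp, by abel⟩

lemma aux_coc_iff (D a : X) (c : ℝ) (hc : 0 < c) :
    ‖D - c • a‖ ≤ c * ‖a‖ ↔ ‖D‖ ^ 2 ≤ 2 * c * ⟪D, a⟫ := by
  have e : ‖D - c • a‖ ^ 2 = ‖D‖ ^ 2 - 2 * c * ⟪D, a⟫ + (c * ‖a‖) ^ 2 := by
    rw [norm_sub_sq_real, inner_smul_right, norm_smul, Real.norm_of_nonneg hc.le]; ring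
  rw [← sq_le_sq₀ (norm_nonneg _) (by positivity), e]
  constructor <;> intro h <;> linarith

set_option maxHeartbeats 1000000 in
lemma aux_coco [CompleteSpace X] (f : X → EReal) (hbot : ∀ x, f x ≠ ⊥)
    (hlsc : LowerSemicontinuous f) (xb : X) (h0 : (0 : X) ∈ LimitingSubdiff f xb) (r ε : ℝ)
    (hr : 0 < r) (hε : 0 < ε) (H : AuxProx f xb r ε) (κ : ℝ) (hκ : 0 < κ) (η : ℝ) (hη : 0 < η)
    (hpos : ∀ x p : X, p ∈ LimitingSubdiff f x → (x, p) ∈ Metric.closedBall (xb, (0 : X)) η →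
        ∀ u w : X, w ∈ CombinedSecondSubdiff f x p u → κ⁻¹ * ‖u‖ ^ 2 ≤ ⟪w, u⟫) :
    ∃ (ρ : ℝ) (P : X → X), 0 < ρ ∧
      (∀ q, ‖q‖ < ρ → q - (r + 1) • (P q - xb) ∈ LimitingSubdiff f (P q) ∧ ‖P q - xb‖ ≤ ε ∧
        ‖q - (r + 1) • (P q - xb)‖ ≤ ε) ∧ P 0 = xb ∧
      ∀ a b, ‖a‖ < ρ → ‖b‖ < ρ → (r + 1 + κ⁻¹) * ‖P a - P b‖ ^ 2 ≤ ⟪P a - P b, a - b⟫ := by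
  set ε' := min η (ε / 2) with hε'
  have hε'p : 0 < ε' := lt_min hη (by positivity)
  have hε'1 : ε' ≤ η := min_le_left _ _
  have hε'2 : ε' ≤ ε / 2 := min_le_right _ _
  set ρ := ε' / (16 * (2 + r)) with hρ
  have hρp : 0 < ρ := by positivity
  have hS : ∀ q : X, ∃ x : X, ‖q‖ ≤ ρ → q - (r + 1) • (x - xb) ∈ LimitingSubdiff f x ∧
      ‖x - xb‖ ≤ ε' ∧ ‖q - (r + 1) • (x - xb)‖ ≤ ε' := by
    intro q
    by_cases hq : ‖q‖ ≤ ρ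
    · obtain ⟨x, p, h1, h2, h3, h4⟩ := aux_surj f hbot hlsc xb h0 r ε ε' hr hε'p (by linarith) H q hq
      have : q - (r + 1) • (x - xb) = p := by rw [← h4]; abel
      exact ⟨x, fun _ => by rw [this]; exact ⟨h1, h2, h3⟩⟩
    · exact ⟨0, fun h => absurd h hq⟩
  choose P hP using hS
  -- uniqueness
  have huniq : ∀ q, ‖q‖ < ρ → ∀ x' p' : X, p' ∈ LimitingSubdiff f x' → ‖x' - xb‖ ≤ ε →
      ‖p'‖ ≤ ε → p' + (r + 1) • (x' - xb) = q → x' = P q := by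
    intro q hq x' p' h1 h2 h3 h4
    obtain ⟨g1, g2, g3⟩ := hP q hq.le
    have := aux_resolvent f xb r ε H x' p' _ _ q q h1 g1 h2 h3 (by linarith) (by linarith) h4
      (by abel)
    rw [sub_self, norm_zero] at this
    exact sub_eq_zero.1 (norm_le_zero_iff.1 this)
  have hLip : ∀ a b, ‖a‖ < ρ → ‖b‖ < ρ → ‖P a - P b‖ ≤ ‖a - b‖ := by
    intro a b ha hb
    obtain ⟨g1, g2, g3⟩ := hP a ha.le
    obtain ⟨g1', g2', g3'⟩ := hP b hb.le
    exact aux_resolvent f xb r ε H _ _ _ _ a b g1 g1' (by linarith) (by linarith) (by linarith)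
      (by linarith) (by abel) (by abel)
  refine ⟨ρ, P, hρp, fun q hq => ?_, ?_, ?_⟩
  · obtain ⟨g1, g2, g3⟩ := hP q hq.le
    exact ⟨g1, by linarith, by linarith⟩
  · exact (huniq 0 (by simpa using hρp) xb 0 h0 (by simpa using hε.le) (by simpa using hε.le)
      (by simp)).symm
  set s := r + 1 with hs
  have hsp : 0 < s := by positivity
  set σ := s + κ⁻¹ with hσ
  have hκi : 0 < κ⁻¹ := inv_pos.2 hκ
  have hσp : 0 < σ := by positivity
  set c := (2 * σ)⁻¹ with hc
  have hcp : 0 < c := by positivity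
  have hcσ : 2 * c * σ = 1 := by rw [hc]; field_simp
  have hmv : ∀ y a b : X, ‖a‖ < ρ → ‖b‖ < ρ →
      (-⟪y, P a⟫ + c * ⟪y, a⟫) - (c * ‖y‖) * ‖b - a‖ ≤ -⟪y, P b⟫ + c * ⟪y, b⟫ := by
    intro y a b ha hb
    refine aux_mv (fun q => -⟪y, P q⟫ + c * ⟪y, q⟫) ρ (‖y‖ + c * ‖y‖) (c * ‖y‖) (by positivity)
      (by positivity) ?_ ?_ a b ha hb
    · intro a b ha hb
      have e : -⟪y, P a⟫ + c * ⟪y, a⟫ - (-⟪y, P b⟫ + c * ⟪y, b⟫)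
        = -⟪y, P a - P b⟫ + c * ⟪y, a - b⟫ := by
        rw [inner_sub_right, inner_sub_right]; ring
      try simp only
      rw [e]
      have h1 := abs_real_inner_le_norm y (P a - P b)
      have h2 := abs_real_inner_le_norm y (a - b)
      have h3 := mul_le_mul_of_nonneg_left (hLip a b ha hb) (norm_nonneg y)
      have h4 := mul_le_mul_of_nonneg_left h2 hcp.le
      rw [abs_le] at h1 ⊢
      have h5 : |c * ⟪y, a - b⟫| ≤ c * (‖y‖ * ‖a - b‖) := by
        rw [abs_mul, abs_of_pos hcp]; exact h4
      rw [abs_le] at h5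
      constructor <;> nlinarith [h1.1, h1.2, h5.1, h5.2]
    · intro q hq v C δ hC hδ hv
      obtain ⟨g1, g2, g3⟩ := hP q hq.le
      set p := q - s • (P q - xb) with hp
      set u := c • y - v with hu
      have hw : y - s • u ∈ CombinedSecondSubdiff f (P q) p u := by
        intro e he
        set δ1 := min (min (min (δ / (1 + s)) ((ρ - ‖q‖) / (1 + s))) (ε / 2))
          (e / ((C + 1) * (1 + s) ^ 2)) with hδ1
        have hA : δ1 ≤ δ / (1 + s) :=
          (min_le_left _ _).trans ((min_le_left _ _).trans (min_le_left _ _))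
        have hB : δ1 ≤ (ρ - ‖q‖) / (1 + s) :=
          (min_le_left _ _).trans ((min_le_left _ _).trans (min_le_right _ _))
        have hD : δ1 ≤ ε / 2 := (min_le_left _ _).trans (min_le_right _ _)
        have hF : δ1 ≤ e / ((C + 1) * (1 + s) ^ 2) := min_le_right _ _
        have hρq : 0 < ρ - ‖q‖ := by linarith
        have hδ1p : 0 < δ1 := by
          refine lt_min (lt_min (lt_min ?_ ?_) ?_) ?_ <;> positivity
        rw [le_div_iff₀ (by positivity)] at hA hB hF
        refine ⟨δ1, hδ1p, ?_⟩
        rintro ⟨x', p'⟩ hz hdist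
        have hz' : p' ∈ LimitingSubdiff f x' := hz
        set D := dist (x', p') (P q, p) with hDdef
        have hD0 : 0 ≤ D := dist_nonneg
        have hx1 : ‖x' - P q‖ ≤ D := by
          rw [hDdef, Prod.dist_eq, ← dist_eq_norm]; exact le_max_left _ _
        have hp1 : ‖p' - p‖ ≤ D := by
          rw [hDdef, Prod.dist_eq, ← dist_eq_norm]; exact le_max_right _ _
        set q' := p' + s • (x' - xb) with hq'
        have hqq : q' - q = (p' - p) + s • (x' - P q) := by
          rw [hq', hp]; module
        have hqn : ‖q' - q‖ ≤ (1 + s) * D := by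
          rw [hqq]
          refine (norm_add_le _ _).trans ?_
          rw [norm_smul, Real.norm_of_nonneg hsp.le]
          nlinarith
        have hqlt : (1 + s) * D < (1 + s) * δ1 := mul_lt_mul_of_pos_left hdist (by positivity)
        have hq'ρ : ‖q'‖ < ρ := by
          have : ‖q'‖ ≤ ‖q' - q‖ + ‖q‖ := by simpa using norm_add_le (q' - q) q
          linarith
        have hx' : x' = P q' := by
          refine huniq q' hq'ρ x' p' hz' ?_ ?_ rfl
          · have : ‖x' - xb‖ ≤ ‖x' - P q‖ + ‖P q - xb‖ := by
              simpa using norm_add_le (x' - P q) (P q - xb)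
            linarith
          · have : ‖p'‖ ≤ ‖p' - p‖ + ‖p‖ := by simpa using norm_add_le (p' - p) p
            linarith
        have h1 := hv q' (by linarith)
        simp only
        have e1 : ⟪y - s • u, x' - P q⟫ + ⟪-u, p' - p⟫ = ⟪y, x' - P q⟫ - ⟪u, q' - q⟫ := by
          rw [hqq, inner_sub_left, inner_smul_left, inner_add_right, inner_smul_right,
            inner_neg_left]
          simp only [conj_trivial]; ring
        have e2 : ⟪u, q' - q⟫ = c * ⟪y, q'⟫ - c * ⟪y, q⟫ - ⟪v, q' - q⟫ := by
          rw [hu, inner_sub_left, inner_smul_left, inner_sub_right y]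
          simp only [conj_trivial]; ring
        have h2 : C * ‖q' - q‖ ^ 2 ≤ e * D := by
          have h3 : ‖q' - q‖ ^ 2 ≤ ((1 + s) * D) ^ 2 := by gcongr
          have h4 : C * ‖q' - q‖ ^ 2 ≤ C * ((1 + s) * D) ^ 2 := by gcongr
          have h5 : C * ((1 + s) * D) ^ 2 ≤ D * ((C + 1) * (1 + s) ^ 2) * D := by
            nlinarith [sq_nonneg ((1 + s) * D)]
          have h6 : D * ((C + 1) * (1 + s) ^ 2) ≤ e :=
            (mul_le_mul_of_nonneg_right hdist.le (by positivity)).trans hF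
          nlinarith
        rw [e1, e2, hx', inner_sub_right]
        try simp only at h1
        linarith
      have h1 := hpos (P q) p g1 (by
        rw [mem_closedBall, Prod.dist_eq, dist_eq_norm, dist_eq_norm, sub_zero]
        exact max_le (by linarith) (by linarith)) u _ hw
      rw [inner_sub_left, inner_smul_left, real_inner_self_eq_norm_sq] at h1
      simp only [conj_trivial] at h1
      have h2 : ‖u‖ ^ 2 ≤ 2 * c * ⟪u, y⟫ := by
        rw [real_inner_comm]
        have : σ * ‖u‖ ^ 2 ≤ ⟪y, u⟫ := by rw [hσ]; linarith
        calc ‖u‖ ^ 2 = 2 * c * (σ * ‖u‖ ^ 2) := by rw [← mul_assoc, hcσ, one_mul]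
          _ ≤ 2 * c * ⟪y, u⟫ := by gcongr
      have h3 := (aux_coc_iff u y c hcp).2 h2
      rw [hu, sub_sub_cancel_left, norm_neg] at h3
      exact h3
  intro a b ha hb
  have h1 : ‖(P a - P b) - c • (a - b)‖ ≤ c * ‖a - b‖ := by
    set y := (P a - P b) - c • (a - b) with hy
    have h2 := hmv y b a hb ha
    have e : ‖y‖ ^ 2 = (⟪y, P a⟫ - c * ⟪y, a⟫) - (⟪y, P b⟫ - c * ⟪y, b⟫) := by
      rw [← real_inner_self_eq_norm_sq]
      nth_rewrite 2 [hy]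
      rw [inner_sub_right, inner_sub_right, inner_smul_right, inner_sub_right]
      ring
    have h3 : ‖y‖ ^ 2 ≤ (c * ‖a - b‖) * ‖y‖ := by rw [e]; linarith
    by_contra hcon
    push Not at hcon
    have : 0 < ‖y‖ := lt_of_le_of_lt (by positivity) hcon
    nlinarith
  have h2 := (aux_coc_iff _ _ c hcp).1 h1
  calc σ * ‖P a - P b‖ ^ 2 ≤ σ * (2 * c * ⟪P a - P b, a - b⟫) := by gcongr
    _ = (2 * c * σ) * ⟪P a - P b, a - b⟫ := by ring
    _ = _ := by rw [hcσ, one_mul]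

set_option maxHeartbeats 1000000 in
lemma aux_backward [CompleteSpace X] (f : X → EReal) (hbot : ∀ x, f x ≠ ⊥)
    (hlsc : LowerSemicontinuous f) (xb : X) (h0 : (0 : X) ∈ LimitingSubdiff f xb) (r ε : ℝ)
    (hr : 0 < r) (hε : 0 < ε) (H : AuxProx f xb r ε) (κ : ℝ) (hκ : 0 < κ) (η : ℝ) (hη : 0 < η)
    (hpos : ∀ x p : X, p ∈ LimitingSubdiff f x → (x, p) ∈ Metric.closedBall (xb, (0 : X)) η →
        ∀ u w : X, w ∈ CombinedSecondSubdiff f x p u → κ⁻¹ * ‖u‖ ^ 2 ≤ ⟪w, u⟫) :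
    TiltStableWith f xb κ := by
  obtain ⟨ρ, P, hρ, hP, hP0, hcoc⟩ := aux_coco f hbot hlsc xb h0 r ε hr hε H κ hκ η hη hpos
  set s := r + 1 with hs
  have hsp : 0 < s := by positivity
  set σ := s + κ⁻¹ with hσ
  have hκi : 0 < κ⁻¹ := inv_pos.2 hκ
  have hσp : 0 < σ := by positivity
  have hLip : ∀ a b, ‖a‖ < ρ → ‖b‖ < ρ → ‖P a - P b‖ ≤ σ⁻¹ * ‖a - b‖ := by
    intro a b ha hb
    have h1 := hcoc a b ha hb
    have h2 := real_inner_le_norm (P a - P b) (a - b)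
    rw [inv_mul_eq_div, le_div_iff₀ hσp]
    by_contra hcon
    push Not at hcon
    have : 0 < ‖P a - P b‖ := by
      by_contra h
      have h0 : ‖P a - P b‖ = 0 := le_antisymm (not_lt.1 h) (norm_nonneg _)
      rw [h0] at hcon
      linarith [norm_nonneg (a - b)]
    nlinarith
  set γ := min ε (ρ / (4 * σ)) with hγ
  have hγp : 0 < γ := lt_min hε (by positivity)
  have hγε : γ ≤ ε := min_le_left _ _
  have hγσ : σ * γ ≤ ρ / 4 := by
    have : γ ≤ ρ / (4 * σ) := min_le_right _ _
    rw [le_div_iff₀ (by positivity)] at this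
    linarith
  set c := s / σ with hc
  have hc0 : 0 ≤ c := by positivity
  have hc1 : c < 1 := by rw [hc, div_lt_one hσp]; linarith
  have hsolve : ∀ p : X, ∃ q : X, ‖p‖ ≤ (1 - c) * (σ * γ) →
      ‖q‖ ≤ σ * γ ∧ p = q - s • (P q - xb) := by
    intro p
    by_cases hp : ‖p‖ ≤ (1 - c) * (σ * γ)
    swap
    · exact ⟨0, fun h => absurd h hp⟩
    obtain ⟨q, hq, hfix⟩ := aux_fixed (fun q => p + s • (P q - xb)) c (σ * γ) hc0 hc1
      (by positivity) (by
        intro a b ha hb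
        have h1 := hLip a b (by linarith) (by linarith)
        have e : p + s • (P a - xb) - (p + s • (P b - xb)) = s • (P a - P b) := by module
        rw [e, norm_smul, Real.norm_of_nonneg hsp.le, hc, div_eq_mul_inv, mul_assoc]
        gcongr) (by simpa [hP0] using hp)
    refine ⟨q, fun _ => ⟨hq, ?_⟩⟩
    nth_rewrite 1 [← hfix]
    abel
  choose Q hQ using hsolve
  have hLipm : ∀ p p' : X, ‖p‖ ≤ (1 - c) * (σ * γ) → ‖p'‖ ≤ (1 - c) * (σ * γ) →
      ‖P (Q p) - P (Q p')‖ ≤ κ * ‖p - p'‖ := by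
    intro p p' hp hp'
    obtain ⟨h1, h2⟩ := hQ p hp
    obtain ⟨h1', h2'⟩ := hQ p' hp'
    have h3 := hcoc (Q p) (Q p') (by linarith) (by linarith)
    set D := P (Q p) - P (Q p') with hD
    have e : Q p - Q p' = (p - p') + s • D := by
      rw [hD]
      have : p - p' = (Q p - s • (P (Q p) - xb)) - (Q p' - s • (P (Q p') - xb)) := by
        rw [← h2, ← h2']
      rw [this]; module
    rw [e, inner_add_right, inner_smul_right, real_inner_self_eq_norm_sq] at h3
    have h4 : κ⁻¹ * ‖D‖ ^ 2 ≤ ⟪D, p - p'⟫ := by linarith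
    have h5 := real_inner_le_norm D (p - p')
    have h6 : ‖D‖ ^ 2 ≤ κ * (‖D‖ * ‖p - p'‖) := by
      have : κ * (κ⁻¹ * ‖D‖ ^ 2) ≤ κ * (‖D‖ * ‖p - p'‖) := by
        refine mul_le_mul_of_nonneg_left (h4.trans h5) hκ.le
      rwa [← mul_assoc, mul_inv_cancel₀ hκ.ne', one_mul] at this
    by_contra hcon
    push Not at hcon
    have : 0 < ‖D‖ := lt_of_le_of_lt (by positivity) hcon
    nlinarith
  have hm0 : P (Q 0) = xb := by
    obtain ⟨h1, h2⟩ := hQ 0 (by rw [norm_zero]; exact mul_nonneg (by linarith) (by positivity))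
    have h3 := hcoc (Q 0) 0 (by linarith) (by simpa using hρ)
    have e : Q 0 = s • (P (Q 0) - xb) := (sub_eq_zero.1 h2.symm)
    rw [hP0, sub_zero] at h3
    nth_rewrite 3 [e] at h3
    rw [inner_smul_right, real_inner_self_eq_norm_sq] at h3
    have h4 : κ⁻¹ * ‖P (Q 0) - xb‖ ^ 2 ≤ 0 := by linarith
    have h5 : ‖P (Q 0) - xb‖ ^ 2 ≤ 0 := by
      by_contra hcon
      push Not at hcon
      nlinarith [mul_pos hκi hcon]
    have h6 : ‖P (Q 0) - xb‖ = 0 := by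
      have := sq_nonneg ‖P (Q 0) - xb‖
      exact pow_eq_zero_iff (two_ne_zero) |>.1 (le_antisymm h5 this)
    exact sub_eq_zero.1 (norm_eq_zero.1 h6)
  -- growth
  have hPfin : ∀ q, ‖q‖ < ρ → f (P q) ≠ ⊤ := by
    intro q hq
    obtain ⟨h1, h2, h3⟩ := hP q hq
    exact (H _ _ h1 h2 h3).1
  have hlow : ∀ q, ‖q‖ < ρ → ∀ y, ‖y - xb‖ ≤ ε → f y ≠ ⊤ →
      ((f (P q)).toReal + s / 2 * ‖P q - xb‖ ^ 2) + ⟪q, y - P q⟫ ≤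
        (f y).toReal + s / 2 * ‖y - xb‖ ^ 2 := by
    intro q hq y hy hyt
    obtain ⟨h1, h2, h3⟩ := hP q hq
    have h4 := (H _ _ h1 h2 h3).2 y hy hyt
    have e : ‖y - xb‖ ^ 2 = ‖P q - xb‖ ^ 2 + 2 * ⟪P q - xb, y - P q⟫ + ‖y - P q‖ ^ 2 := by
      rw [← norm_add_sq_real]; congr 2; abel
    rw [inner_sub_left, inner_smul_left] at h4
    simp only [conj_trivial] at h4
    rw [e]
    nlinarith [sq_nonneg ‖y - P q‖]
  have hgrow : ∀ p, ‖p‖ ≤ (1 - c) * (σ * γ) → ∀ y, ‖y - xb‖ ≤ γ → f y ≠ ⊤ →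
      (f (P (Q p))).toReal + ⟪p, y - P (Q p)⟫ + κ⁻¹ / 2 * ‖y - P (Q p)‖ ^ 2 ≤ (f y).toReal := by
    intro p hp y hy hyt
    obtain ⟨h1, h2⟩ := hQ p hp
    set q := Q p with hq
    have hqρ : ‖q‖ < ρ := by linarith
    have h3 := hLip q 0 hqρ (by simpa using hρ)
    rw [hP0, sub_zero] at h3
    have h4 : ‖y - P q‖ ≤ γ + σ⁻¹ * ‖q‖ := by
      have : ‖y - P q‖ ≤ ‖y - xb‖ + ‖P q - xb‖ := by
        have := norm_sub_le (y - xb) (P q - xb)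
        simpa using this
      linarith
    have h5 := aux_growth (fun q => (f (P q)).toReal + s / 2 * ‖P q - xb‖ ^ 2) P ρ σ⁻¹
      (by positivity)
      (fun a b ha hb => hlow a ha (P b) (hP b hb).2.1 (hPfin b hb)) hLip q y
      ((f y).toReal + s / 2 * ‖y - xb‖ ^ 2) hqρ
      (by
        refine lt_of_le_of_lt (norm_add_le _ _) ?_
        rw [inv_inv, norm_smul, Real.norm_of_nonneg hσp.le]
        have : σ * ‖y - P q‖ ≤ σ * (γ + σ⁻¹ * ‖q‖) := by gcongr
        rw [mul_add, ← mul_assoc, mul_inv_cancel₀ hσp.ne', one_mul] at this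
        linarith)
      (fun a ha => hlow a ha y (by linarith) hyt)
    have e : ‖y - xb‖ ^ 2 = ‖P q - xb‖ ^ 2 + 2 * ⟪P q - xb, y - P q⟫ + ‖y - P q‖ ^ 2 := by
      rw [← norm_add_sq_real]; congr 2; abel
    simp only [inv_inv] at h5
    rw [e] at h5
    have e2 : ⟪p, y - P q⟫ = ⟪q, y - P q⟫ - s * ⟪P q - xb, y - P q⟫ := by
      rw [h2, inner_sub_left, inner_smul_left]; simp
    rw [e2]
    rw [hσ] at h5
    linarith
  have hVp : 0 < (1 - c) * (σ * γ) := mul_pos (by linarith) (by positivity)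
  refine ⟨γ, hγp, closedBall 0 ((1 - c) * (σ * γ)), closedBall_mem_nhds _ hVp,
    fun p => P (Q p), ?_, ?_, hm0⟩
  · intro p hp
    rw [mem_closedBall_zero_iff] at hp
    obtain ⟨h1, h2⟩ := hQ p hp
    have hqρ : ‖Q p‖ < ρ := by linarith
    have hfin := hPfin _ hqρ
    have hin : ‖P (Q p) - xb‖ ≤ γ := by
      have h3 := hLip (Q p) 0 hqρ (by simpa using hρ)
      rw [hP0, sub_zero] at h3
      refine h3.trans ?_
      rw [inv_mul_le_iff₀ hσp]; exact h1
    ext x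
    rw [Set.mem_singleton_iff]
    constructor
    · rintro ⟨hx, hxmin⟩
      rw [mem_closedBall, dist_eq_norm] at hx
      have h3 := hxmin (P (Q p)) (by rw [mem_closedBall, dist_eq_norm]; exact hin)
      have hxt : f x ≠ ⊤ := by
        intro htop
        rw [htop, aux_coe f hbot _ hfin, ← EReal.coe_sub, EReal.top_sub_coe] at h3
        exact absurd h3 (not_le.2 (EReal.coe_lt_top _))
      rw [aux_coe f hbot _ hfin, aux_coe f hbot _ hxt, ← EReal.coe_sub, ← EReal.coe_sub,
        EReal.coe_le_coe_iff] at h3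
      have h4 := hgrow p hp x hx hxt
      rw [inner_sub_right] at h4
      have h5 : κ⁻¹ / 2 * ‖x - P (Q p)‖ ^ 2 ≤ 0 := by linarith
      by_contra hne
      have : 0 < ‖x - P (Q p)‖ := norm_pos_iff.2 (sub_ne_zero.2 hne)
      have : 0 < κ⁻¹ / 2 * ‖x - P (Q p)‖ ^ 2 := by positivity
      linarith
    · rintro rfl
      refine ⟨by rw [mem_closedBall, dist_eq_norm]; exact hin, fun y hy => ?_⟩
      rw [mem_closedBall, dist_eq_norm] at hy
      by_cases hyt : f y = ⊤
      · rw [hyt, EReal.top_sub_coe]; exact le_top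
      have h4 := hgrow p hp y hy hyt
      rw [aux_coe f hbot _ hfin, aux_coe f hbot _ hyt, ← EReal.coe_sub, ← EReal.coe_sub,
        EReal.coe_le_coe_iff]
      rw [inner_sub_right] at h4
      have : 0 ≤ κ⁻¹ / 2 * ‖y - P (Q p)‖ ^ 2 := by positivity
      linarith
  · refine LipschitzOnWith.of_dist_le_mul ?_
    intro p hp p' hp'
    rw [mem_closedBall_zero_iff] at hp hp'
    rw [Real.coe_toNNReal _ hκ.le, dist_eq_norm, dist_eq_norm]
    exact hLipm p p' hp hp'

set_option maxHeartbeats 1000000 in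
lemma aux_forward [CompleteSpace X] (f : X → EReal) (hbot : ∀ x, f x ≠ ⊥)
    (xb : X) (h0 : (0 : X) ∈ LimitingSubdiff f xb) (r ε : ℝ)
    (hr : 0 < r) (hε : 0 < ε) (H : AuxProx f xb r ε) (κ : ℝ) (hκ : 0 < κ)
    (hT : TiltStableWith f xb κ) :
    ∃ η : ℝ, 0 < η ∧
      ∀ x p : X, p ∈ LimitingSubdiff f x → (x, p) ∈ Metric.closedBall (xb, (0 : X)) η →
        ∀ u w : X, w ∈ CombinedSecondSubdiff f x p u → κ⁻¹ * ‖u‖ ^ 2 ≤ ⟪w, u⟫ := by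
  obtain ⟨γ, hγ, V, hV, m, hm, hLip, hm0⟩ := hT
  obtain ⟨hfin, -⟩ := H xb 0 h0 (by simpa using hε.le) (by simpa using hε.le)
  obtain ⟨ρ0, hρ0, hρV⟩ := Metric.mem_nhds_iff.1 hV
  set ρ := min ρ0 (γ / (2 * κ)) with hρ
  have hρp : 0 < ρ := lt_min hρ0 (by positivity)
  have hρ1 : ρ ≤ ρ0 := min_le_left _ _
  have hρ2 : κ * ρ ≤ γ / 2 := by
    have : ρ ≤ γ / (2 * κ) := min_le_right _ _
    rw [le_div_iff₀ (by positivity)] at this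
    linarith
  have hinV : ∀ p : X, ‖p‖ < ρ → p ∈ V := fun p hp => hρV (by
    rw [mem_ball_zero_iff]; linarith)
  have hL : ∀ p p' : X, ‖p‖ < ρ → ‖p'‖ < ρ → ‖m p - m p'‖ ≤ κ * ‖p - p'‖ := by
    intro p p' hp hp'
    have := hLip.dist_le_mul p (hinV p hp) p' (hinV p' hp')
    rwa [Real.coe_toNNReal _ hκ.le, dist_eq_norm, dist_eq_norm] at this
  have hmb : ∀ p : X, ‖p‖ < ρ → ‖m p - xb‖ ≤ κ * ‖p‖ := by
    intro p hp
    have := hL p 0 hp (by simpa using hρp)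
    rwa [hm0, sub_zero] at this
  have hmγ : ∀ p : X, ‖p‖ < ρ → ‖m p - xb‖ ≤ γ / 2 := by
    intro p hp
    exact (hmb p hp).trans ((mul_le_mul_of_nonneg_left hp.le hκ.le).trans hρ2)
  have hmem : ∀ p : X, ‖p‖ < ρ → m p ∈ TiltArgmin f xb γ p := by
    intro p hp; rw [hm p (hinV p hp)]; rfl
  have hmfin : ∀ p : X, ‖p‖ < ρ → f (m p) ≠ ⊤ := by
    intro p hp htop
    have h3 := (hmem p hp).2 xb (by simpa using hγ.le)
    rw [htop, aux_coe f hbot _ hfin, ← EReal.coe_sub, EReal.top_sub_coe] at h3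
    exact absurd h3 (not_le.2 (EReal.coe_lt_top _))
  have hsub0 : ∀ p : X, ‖p‖ < ρ → ∀ y, ‖y - xb‖ ≤ γ → f y ≠ ⊤ →
      (f (m p)).toReal + ⟪p, y - m p⟫ ≤ (f y).toReal := by
    intro p hp y hy hyt
    have h3 := (hmem p hp).2 y (by rw [mem_closedBall, dist_eq_norm]; exact hy)
    rw [aux_coe f hbot _ (hmfin p hp), aux_coe f hbot _ hyt, ← EReal.coe_sub, ← EReal.coe_sub,
        EReal.coe_le_coe_iff] at h3
    rw [inner_sub_right]; linarith
  have hgraph : ∀ p : X, ‖p‖ < ρ → p ∈ LimitingSubdiff f (m p) := by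
    intro p hp
    refine aux_limiting f _ _ (aux_frechet f hbot _ _ (hmfin p hp) 0 (γ / 2) le_rfl
      (by positivity) ?_)
    intro y hy hyt
    have h1 := hmγ p hp
    have : ‖y - xb‖ ≤ ‖y - m p‖ + ‖m p - xb‖ := by simpa using norm_add_le (y - m p) (m p - xb)
    have := hsub0 p hp y (by linarith) hyt
    linarith
  have hgrow : ∀ p q : X, ‖p‖ < ρ / 3 → ‖q‖ < ρ / 3 →
      (f (m p)).toReal + ⟪p, m q - m p⟫ + κ⁻¹ / 2 * ‖m q - m p‖ ^ 2 ≤ (f (m q)).toReal := by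
    intro p q hp hq
    have hp' : ‖p‖ < ρ := by linarith
    have hq' : ‖q‖ < ρ := by linarith
    refine aux_growth (fun p => (f (m p)).toReal) m ρ κ hκ
      (fun a b ha hb => hsub0 a ha _ ((hmγ b hb).trans (by linarith)) (hmfin b hb)) hL p (m q) _
      hp' ?_ (fun a ha => hsub0 a ha _ ((hmγ q hq').trans (by linarith)) (hmfin q hq'))
    refine lt_of_le_of_lt (norm_add_le _ _) ?_
    rw [norm_smul, Real.norm_of_nonneg (by positivity)]
    have h1 := hL q p hq' hp'
    have h2 : κ⁻¹ * ‖m q - m p‖ ≤ ‖q - p‖ := by rw [inv_mul_le_iff₀ hκ]; exact h1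
    have h3 := norm_sub_le q p
    linarith
  have hcoc : ∀ p q : X, ‖p‖ < ρ / 3 → ‖q‖ < ρ / 3 →
      ‖(m p - m q) - (κ / 2) • (p - q)‖ ≤ κ / 2 * ‖p - q‖ := by
    intro p q hp hq
    rw [aux_coc_iff _ _ _ (by positivity)]
    have h1 := hgrow p q hp hq
    have h2 := hgrow q p hq hp
    rw [norm_sub_rev (m q)] at h1
    have e : ⟪p, m q - m p⟫ = -⟪m p - m q, p⟫ := by
      rw [real_inner_comm, ← inner_neg_left, neg_sub]
    rw [e] at h1
    rw [real_inner_comm] at h2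
    have h3 : κ⁻¹ * ‖m p - m q‖ ^ 2 ≤ ⟪m p - m q, p - q⟫ := by
      rw [inner_sub_right]; linarith
    rw [inv_mul_le_iff₀ hκ] at h3
    linarith
  -- localization of the graph
  set s := r + 1 with hs
  have hsp : 0 < s := by positivity
  set ρ' := min (ρ / 6) (min (ε / κ) ε) with hρ'
  have hρ'p : 0 < ρ' := lt_min (by positivity) (lt_min (by positivity) hε)
  have hρ'1 : ρ' ≤ ρ / 6 := min_le_left _ _
  have hρ'2 : κ * ρ' ≤ ε := by
    have : ρ' ≤ ε / κ := (min_le_right _ _).trans (min_le_left _ _)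
    rw [le_div_iff₀ hκ] at this; linarith
  have hρ'3 : ρ' ≤ ε := (min_le_right _ _).trans (min_le_right _ _)
  set η := ρ' / (1 + s) with hη
  have hηp : 0 < η := by positivity
  have hηe : (1 + s) * η = ρ' := by rw [hη]; field_simp
  have hηρ : η ≤ ρ' := by nlinarith
  have hloc : ∀ x p : X, p ∈ LimitingSubdiff f x → ‖x - xb‖ ≤ η → ‖p‖ ≤ η → x = m p := by
    intro x p hp hx hpn
    set z := p + s • (x - xb) with hz
    have hzn : ‖z‖ ≤ ρ' := by
      refine (norm_add_le _ _).trans ?_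
      rw [norm_smul, Real.norm_of_nonneg hsp.le]
      nlinarith
    set k := 1 + s * (κ / 2) with hk
    have hkp : 0 < k := by positivity
    obtain ⟨q, hq, hfix⟩ := aux_fixed
      (fun q => k⁻¹ • (z - s • ((m q - xb) - (κ / 2) • q))) (k⁻¹ * (s * (κ / 2))) ρ'
      (by positivity) (by rw [inv_mul_lt_iff₀ hkp]; linarith) hρ'p.le
      (by
        intro a b ha hb
        have h1 := hcoc a b (by linarith) (by linarith)
        have e : k⁻¹ • (z - s • ((m a - xb) - (κ / 2) • a)) -
            k⁻¹ • (z - s • ((m b - xb) - (κ / 2) • b))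
            = -(k⁻¹ • (s • ((m a - m b) - (κ / 2) • (a - b)))) := by module
        rw [e, norm_neg, norm_smul, norm_smul, Real.norm_of_nonneg hsp.le,
          Real.norm_of_nonneg (by positivity), mul_assoc, mul_assoc]
        gcongr)
      (by
        simp only [hm0, sub_self, smul_zero, sub_zero]
        rw [norm_smul, Real.norm_of_nonneg (by positivity)]
        have e : (1 - k⁻¹ * (s * (κ / 2))) = k⁻¹ := by
          have : s * (κ / 2) = k - 1 := by rw [hk]; ring
          rw [this]; field_simp; ring
        rw [e]
        gcongr)
    have hqz : q + s • (m q - xb) = z := by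
      have h1 : k • q = z - s • ((m q - xb) - (κ / 2) • q) := by
        nth_rewrite 1 [← hfix]
        try simp only
        rw [smul_smul, mul_inv_cancel₀ hkp.ne', one_smul]
      have h2 : k • q = q + (s * (κ / 2)) • q := by rw [hk]; module
      rw [h2] at h1
      have h3 : z = q + (s * (κ / 2)) • q + s • ((m q - xb) - (κ / 2) • q) := by
        rw [h1]; abel
      rw [h3]; module
    have hqρ : ‖q‖ < ρ := by linarith
    have h1 := aux_resolvent f xb r ε H x p (m q) q z z hp (hgraph q hqρ) (by linarith)
      (by linarith) ((hmb q hqρ).trans ((mul_le_mul_of_nonneg_left hq hκ.le).trans hρ'2))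
      (by linarith) hz.symm hqz
    rw [sub_self, norm_zero] at h1
    have h2 : x = m q := sub_eq_zero.1 (norm_le_zero_iff.1 h1)
    have h3 : p = q := by
      rw [← h2, hz] at hqz
      exact (add_right_cancel hqz).symm
    rw [h3]; exact h2
  refine ⟨η, hηp, ?_⟩
  intro x p hp hball u w hw
  rw [mem_closedBall, Prod.dist_eq, dist_eq_norm, dist_eq_norm, sub_zero] at hball
  have hx := (le_max_left _ _).trans hball
  have hpn := (le_max_right _ _).trans hball
  simp only at hx hpn
  have hxm := hloc x p hp hx hpn
  set v := u - (κ / 2) • w with hv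
  have hest : ∀ e : ℝ, 0 < e → ‖v‖ ^ 2 ≤ κ / 2 * ‖w‖ * ‖v‖ + e * (κ + 1) * ‖v‖ := by
    intro e he
    obtain ⟨δ, hδ, hN⟩ := hw e he
    set t := min (δ / (2 * (κ + 1) * (‖v‖ + 1))) (ρ / (12 * (‖v‖ + 1))) with ht
    have hv0 := norm_nonneg v
    have htp : 0 < t := lt_min (by positivity) (by positivity)
    have ht1 : t * (2 * (κ + 1) * (‖v‖ + 1)) ≤ δ := by
      have : t ≤ _ := min_le_left _ _
      rwa [le_div_iff₀ (by positivity)] at this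
    have ht2 : t * (12 * (‖v‖ + 1)) ≤ ρ := by
      have : t ≤ _ := min_le_right _ _
      rwa [le_div_iff₀ (by positivity)] at this
    set q := p - t • v with hq
    have hqp : q - p = -(t • v) := by rw [hq]; abel
    have hqpn : ‖q - p‖ = t * ‖v‖ := by
      rw [hqp, norm_neg, norm_smul, Real.norm_of_nonneg htp.le]
    have hp3 : ‖p‖ < ρ / 3 := by linarith
    have hq3 : ‖q‖ < ρ / 3 := by
      have : ‖q‖ ≤ ‖q - p‖ + ‖p‖ := by simpa using norm_add_le (q - p) p
      nlinarith
    have h1 := hL q p (by linarith) (by linarith)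
    have hdist : dist (m q, q) (x, p) ≤ (κ + 1) * (t * ‖v‖) := by
      have : 0 ≤ t * ‖v‖ := by positivity
      rw [Prod.dist_eq, dist_eq_norm, dist_eq_norm, hxm]
      refine max_le ?_ ?_
      · simp only; rw [hqpn] at h1; nlinarith
      · simp only; rw [hqpn]; nlinarith
    have h2 := hN (m q, q) (hgraph q (by linarith)) (by
      refine lt_of_le_of_lt hdist ?_
      have h5 : (κ + 1) * (t * ‖v‖) < t * (2 * (κ + 1) * (‖v‖ + 1)) := by
        have : 0 < t * (κ + 1) := by positivity
        nlinarith
      linarith)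
    simp only at h2
    have h3 : ⟪w, m q - x⟫ + ⟪-u, q - p⟫ ≤ e * ((κ + 1) * (t * ‖v‖)) :=
      h2.trans (mul_le_mul_of_nonneg_left hdist he.le)
    have h4 := hcoc q p hq3 hp3
    set N := (m q - m p) - (κ / 2) • (q - p) with hNdef
    have h5 : m q - x = N - (κ / 2 * t) • v := by
      rw [hNdef, hqp, hxm]; module
    have h6 : -(‖w‖ * (κ / 2 * (t * ‖v‖))) ≤ ⟪w, N⟫ := by
      have h7 := (abs_le.1 (abs_real_inner_le_norm w N)).1
      rw [hqpn] at h4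
      have := mul_le_mul_of_nonneg_left h4 (norm_nonneg w)
      linarith
    rw [h5, hqp, inner_sub_right, inner_smul_right, inner_neg_neg, inner_smul_right] at h3
    have h8 : ‖v‖ ^ 2 = ⟪u, v⟫ - κ / 2 * ⟪w, v⟫ := by
      rw [← real_inner_self_eq_norm_sq]
      nth_rewrite 1 [hv]
      rw [inner_sub_left, inner_smul_left]; simp
    have h9 : t * ‖v‖ ^ 2 ≤ t * (κ / 2 * ‖w‖ * ‖v‖ + e * (κ + 1) * ‖v‖) := by
      rw [h8]; linarith
    exact le_of_mul_le_mul_left h9 htp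
  have hvle : ‖v‖ ≤ κ / 2 * ‖w‖ := by
    by_contra hcon
    push Not at hcon
    have hvp : 0 < ‖v‖ := lt_of_le_of_lt (by positivity) hcon
    have h1 := hest ((‖v‖ - κ / 2 * ‖w‖) / (2 * (κ + 1))) (div_pos (by linarith) (by positivity))
    have e : (‖v‖ - κ / 2 * ‖w‖) / (2 * (κ + 1)) * (κ + 1) = (‖v‖ - κ / 2 * ‖w‖) / 2 := by
      field_simp
    rw [e] at h1
    nlinarith
  have h1 := (aux_coc_iff u w (κ / 2) (by positivity)).1 hvle
  rw [inv_mul_le_iff₀ hκ, real_inner_comm]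
  linarith

end TiltAux

/-- Corollary 4.10: tilt stability with modulus `κ` is characterized by positive-definiteness
of the combined second-order subdifferential with constant `κ⁻¹`. -/
theorem tilt_stability_iff_combined_second_order_positivity {X : Type*} [NormedAddCommGroup X] [InnerProductSpace ℝ X] [CompleteSpace X]
    (f : X → EReal)
    (hproper : ∃ x, f x ≠ ⊤) (hbot : ∀ x, f x ≠ ⊥) (hlsc : LowerSemicontinuous f)
    (xb : X) (h0 : (0 : X) ∈ LimitingSubdiff f xb)
    (hpr : ProxRegularAt f xb 0) (hsc : SubdiffContAt f xb 0)
    (κ : ℝ) (hκ : 0 < κ) :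
    TiltStableWith f xb κ ↔
    ∃ η : ℝ, 0 < η ∧
      ∀ x p : X, p ∈ LimitingSubdiff f x → (x, p) ∈ Metric.closedBall (xb, (0 : X)) η →
        ∀ u w : X, w ∈ CombinedSecondSubdiff f x p u → κ⁻¹ * ‖u‖ ^ 2 ≤ ⟪w, u⟫ := by
  obtain ⟨r, ε, hr, hε, H⟩ := aux_setup f hbot xb hpr hsc
  constructor
  · exact aux_forward f hbot xb h0 r ε hr hε H κ hκ
  · rintro ⟨η, hη, hpos⟩
    exact aux_backward f hbot hlsc xb h0 r ε hr hε H κ hκ η hη hpos
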